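/- arXiv:1411.2451 — 4 statements merged into one kernel-verified Lean document; each statement's English description precedes it below -/
import Mathlib

section
/- Let D ≥ 2 and let ε > 0 be small enough (less than a constant depending only on D). Then there exists η > 0 depending on ε and D such that the following holds: for every Θ ∈ SO(D) and all radii 0 < r_1 ≤ η r_2, there exists an ε-distorted diffeomorphism Φ : ℝ^D → ℝ^D such that Φ(x) = Θx for |x| ≤ r_1 and Φ(x) = x for |x| ≥ r_2. -/
/-- A diffeomorphism `Φ : ℝ^D → ℝ^D` is `ε`-distorted if it is a smooth bijection with
smooth inverse and `(1+ε)⁻¹ I ≤ (DΦ(x))ᵀ (DΦ(x)) ≤ (1+ε) I` as quadratic forms, i.e.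
`(1+ε)⁻¹ ‖v‖² ≤ ‖DΦ(x) v‖² ≤ (1+ε) ‖v‖²` for all `x, v`. -/
def IsDistorted (D : ℕ) (ε : ℝ)
    (Φ : EuclideanSpace ℝ (Fin D) → EuclideanSpace ℝ (Fin D)) : Prop :=
  Function.Bijective Φ ∧
  ContDiff ℝ (⊤ : ℕ∞) Φ ∧
  ContDiff ℝ (⊤ : ℕ∞) (Function.invFun Φ) ∧
  ∀ (x v : EuclideanSpace ℝ (Fin D)),
    (1 + ε)⁻¹ * ‖v‖ ^ 2 ≤ ‖fderiv ℝ Φ x v‖ ^ 2 ∧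
    ‖fderiv ℝ Φ x v‖ ^ 2 ≤ (1 + ε) * ‖v‖ ^ 2


open scoped ContDiff
open Module

/-- A radial cutoff varying slowly on the logarithmic scale. -/
theorem slow_cutoff (D : ℕ) : ∃ K > (0 : ℝ), ∀ r₁ r₂ : ℝ, 0 < r₁ → r₁ < r₂ →
    ∃ g : ℝ → ℝ, ContDiff ℝ (⊤ : ℕ∞) (fun x : EuclideanSpace ℝ (Fin D) => g ‖x‖) ∧
      (∀ r, 0 ≤ r → r ≤ r₁ → g r = 0) ∧ (∀ r, r₂ ≤ r → g r = 1) ∧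
      ∀ x v : EuclideanSpace ℝ (Fin D),
        |fderiv ℝ (fun x : EuclideanSpace ℝ (Fin D) => g ‖x‖) x v| * ‖x‖
          ≤ K / Real.log (r₂ / r₁) * ‖v‖ := by
  have hcd : ContDiff ℝ (⊤ : ℕ∞) Real.smoothTransition := Real.smoothTransition.contDiff
  have hc : Continuous (deriv Real.smoothTransition) := hcd.continuous_deriv (by simp)
  obtain ⟨C, hC⟩ := (isCompact_Icc (a := (0 : ℝ)) (b := 1)).exists_bound_of_continuousOn
    hc.continuousOn
  have hC' : ∀ t, |deriv Real.smoothTransition t| ≤ |C| + 1 := by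
    intro t
    by_cases ht : t ∈ Set.Icc (0 : ℝ) 1
    · have := hC t ht
      rw [Real.norm_eq_abs] at this
      linarith [le_abs_self C]
    · have h0 : deriv Real.smoothTransition t = 0 := by
        rw [Set.mem_Icc, not_and_or, not_le, not_le] at ht
        rcases ht with ht | ht
        · have : Real.smoothTransition =ᶠ[nhds t] fun _ => 0 := by
            filter_upwards [Iio_mem_nhds ht] with s hs
            exact Real.smoothTransition.zero_of_nonpos (le_of_lt hs)
          rw [this.deriv_eq]; simp
        · have : Real.smoothTransition =ᶠ[nhds t] fun _ => 1 := by
            filter_upwards [Ioi_mem_nhds ht] with s hs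
            exact Real.smoothTransition.one_of_one_le (le_of_lt hs)
          rw [this.deriv_eq]; simp
      rw [h0, abs_zero]; positivity
  refine ⟨|C| + 1, by positivity, fun r₁ r₂ h1 h12 => ?_⟩
  have hL : 0 < Real.log (r₂ / r₁) := Real.log_pos (by rwa [one_lt_div h1])
  set L := Real.log (r₂ / r₁) with hLdef
  refine ⟨fun r => Real.smoothTransition (Real.log (r / r₁) / L), ?_, ?_, ?_, ?_⟩
  · rw [contDiff_iff_contDiffAt]
    intro x
    by_cases hx : x = 0
    · subst hx
      have : (fun x : EuclideanSpace ℝ (Fin D) =>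
          Real.smoothTransition (Real.log (‖x‖ / r₁) / L)) =ᶠ[nhds 0] fun _ => 0 := by
        filter_upwards [Metric.ball_mem_nhds 0 h1] with y hy
        apply Real.smoothTransition.zero_of_nonpos
        apply div_nonpos_of_nonpos_of_nonneg _ hL.le
        apply Real.log_nonpos (by positivity)
        rw [div_le_one h1]
        exact (mem_ball_zero_iff.1 hy).le
      exact contDiffAt_const.congr_of_eventuallyEq this
    · refine hcd.contDiffAt.comp x ?_
      refine ContDiffAt.div_const ?_ _
      refine ContDiffAt.log ?_ (by simp [hx, h1.ne'])
      exact (contDiffAt_norm ℝ hx).div_const _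
  · intro r h0 hr
    apply Real.smoothTransition.zero_of_nonpos
    apply div_nonpos_of_nonpos_of_nonneg _ hL.le
    apply Real.log_nonpos (by positivity)
    rwa [div_le_one h1]
  · intro r hr
    apply Real.smoothTransition.one_of_one_le
    rw [one_le_div hL]
    apply Real.log_le_log (by have := h1.trans h12; positivity)
    gcongr
  · intro x v
    by_cases hx : x = 0
    · subst hx
      simp only [norm_zero, mul_zero]
      positivity
    have hxn : 0 < ‖x‖ := norm_pos_iff.2 hx
    have hN : HasFDerivAt (fun x : EuclideanSpace ℝ (Fin D) => ‖x‖) (fderiv ℝ norm x) x :=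
      ((contDiffAt_norm (n := 1) ℝ hx).differentiableAt (by simp)).hasFDerivAt
    have hNb : |fderiv ℝ norm x v| ≤ ‖v‖ := by
      have h := norm_fderiv_le_of_lipschitz ℝ (f := (norm : EuclideanSpace ℝ (Fin D) → ℝ))
        (x₀ := x) lipschitzWith_one_norm
      calc |fderiv ℝ norm x v| ≤ ‖fderiv ℝ norm x‖ * ‖v‖ := (fderiv ℝ norm x).le_opNorm v
        _ ≤ 1 * ‖v‖ := by gcongr; simpa using h
        _ = ‖v‖ := one_mul _
    have hd : HasDerivAt (fun r => Real.smoothTransition (Real.log (r / r₁) / L))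
        (deriv Real.smoothTransition (Real.log (‖x‖ / r₁) / L) * ((1 / r₁) / (‖x‖ / r₁) / L)) ‖x‖ := by
      have h1' : HasDerivAt (fun r => Real.log (r / r₁) / L) ((1 / r₁) / (‖x‖ / r₁) / L) ‖x‖ :=
        (((hasDerivAt_id ‖x‖).div_const r₁).log (by simp [hx, h1.ne'])).div_const L
      have h2' : HasDerivAt Real.smoothTransition
          (deriv Real.smoothTransition (Real.log (‖x‖ / r₁) / L)) (Real.log (‖x‖ / r₁) / L) :=
        ((hcd.differentiable (by simp)) _).hasDerivAt
      exact h2'.comp ‖x‖ h1'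
    have hF := hd.comp_hasFDerivAt x hN
    have hF' : fderiv ℝ (fun x : EuclideanSpace ℝ (Fin D) =>
        Real.smoothTransition (Real.log (‖x‖ / r₁) / L)) x = _ := hF.fderiv
    rw [hF']
    have he : (1 / r₁) / (‖x‖ / r₁) / L = 1 / (‖x‖ * L) := by field_simp
    rw [_root_.smul_apply, smul_eq_mul, he, abs_mul, abs_mul,
      abs_of_pos (show 0 < 1 / (‖x‖ * L) by positivity)]
    calc _ ≤ (|C| + 1) * (1 / (‖x‖ * L)) * ‖v‖ * ‖x‖ := by
          gcongr
          exact hC' _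
      _ = _ := by field_simp

/-- Twists of a given distortion `c` interpolating between `φ` and the identity. -/
def Tw (D : ℕ) (r₁ r₂ c : ℝ)
    (φ : EuclideanSpace ℝ (Fin D) ≃ₗᵢ[ℝ] EuclideanSpace ℝ (Fin D)) : Prop :=
  ∃ Φ Ψ : EuclideanSpace ℝ (Fin D) → EuclideanSpace ℝ (Fin D),
    ContDiff ℝ (⊤ : ℕ∞) Φ ∧ ContDiff ℝ (⊤ : ℕ∞) Ψ ∧ (∀ x, Ψ (Φ x) = x) ∧ (∀ x, Φ (Ψ x) = x) ∧
    (∀ x, ‖Φ x‖ = ‖x‖) ∧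
    (∀ x v, c⁻¹ * ‖v‖ ^ 2 ≤ ‖fderiv ℝ Φ x v‖ ^ 2 ∧ ‖fderiv ℝ Φ x v‖ ^ 2 ≤ c * ‖v‖ ^ 2) ∧
    (∀ x, ‖x‖ ≤ r₁ → Φ x = φ x) ∧ (∀ x, r₂ ≤ ‖x‖ → Φ x = x)

theorem tw_one (D : ℕ) (r₁ r₂ : ℝ) : Tw D r₁ r₂ 1 1 :=
  ⟨id, id, contDiff_id, contDiff_id, fun _ => rfl, fun _ => rfl, fun _ => rfl,
    fun x v => by simp, fun _ _ => rfl, fun _ _ => rfl⟩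

theorem Tw.mono {D : ℕ} {r₁ r₂ c c' : ℝ} {φ} (h : Tw D r₁ r₂ c φ) (hc : 0 < c) (hcc : c ≤ c') :
    Tw D r₁ r₂ c' φ := by
  obtain ⟨Φ, Ψ, h1, h2, h3, h4, h5, h6, h7, h8⟩ := h
  refine ⟨Φ, Ψ, h1, h2, h3, h4, h5, fun x v => ⟨?_, ?_⟩, h7, h8⟩
  · refine le_trans ?_ (h6 x v).1
    gcongr
  · refine (h6 x v).2.trans ?_
    gcongr

theorem Tw.mul {D : ℕ} {r₁ r₂ c c' : ℝ} {φ φ'} (h : Tw D r₁ r₂ c φ) (h' : Tw D r₁ r₂ c' φ')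
    (hc : 0 < c) : Tw D r₁ r₂ (c * c') (φ * φ') := by
  obtain ⟨Φ, Ψ, h1, h2, h3, h4, h5, h6, h7, h8⟩ := h
  obtain ⟨Φ', Ψ', h1', h2', h3', h4', h5', h6', h7', h8'⟩ := h'
  refine ⟨Φ ∘ Φ', Ψ' ∘ Ψ, h1.comp h1', h2'.comp h2, fun x => by simp [h3, h3'],
    fun x => by simp [h4, h4'], fun x => by simp [h5, h5'], fun x v => ?_, fun x hx => ?_,
    fun x hx => ?_⟩
  · rw [fderiv_comp x (h1.differentiable (by simp) _) (h1'.differentiable (by simp) _),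
      ContinuousLinearMap.comp_apply]
    have a := h6 (Φ' x) (fderiv ℝ Φ' x v)
    have b := h6' x v
    constructor
    · calc (c * c')⁻¹ * ‖v‖ ^ 2 = c⁻¹ * (c'⁻¹ * ‖v‖ ^ 2) := by rw [mul_inv]; ring
        _ ≤ c⁻¹ * ‖fderiv ℝ Φ' x v‖ ^ 2 := by gcongr; exact b.1
        _ ≤ _ := a.1
    · calc _ ≤ c * ‖fderiv ℝ Φ' x v‖ ^ 2 := a.2
        _ ≤ c * (c' * ‖v‖ ^ 2) := by gcongr; exact b.2
        _ = _ := by ring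
  · have : Φ' x = φ' x := h7' x hx
    simp only [Function.comp_apply, this]
    exact h7 _ (by simpa using hx)
  · simp only [Function.comp_apply, h8' x hx, h8 x hx]

/-- Reflection in the hyperplane orthogonal to `v`. -/
noncomputable def Rf {D : ℕ} (v : EuclideanSpace ℝ (Fin D)) :
    EuclideanSpace ℝ (Fin D) ≃ₗᵢ[ℝ] EuclideanSpace ℝ (Fin D) := (ℝ ∙ v)ᗮ.reflection

theorem Rf_apply {D : ℕ} {v : EuclideanSpace ℝ (Fin D)} (hv : ‖v‖ = 1) (x) :
    Rf v x = x - (2 * inner ℝ v x) • v := by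
  rw [Rf, Submodule.reflection_orthogonal_apply, Submodule.reflection_singleton_apply, hv]
  simp only [RCLike.ofReal_real_eq_id, id, one_pow, div_one, neg_sub, mul_smul]
  rw [two_smul, two_smul]

theorem Rf_invol {D : ℕ} (v x : EuclideanSpace ℝ (Fin D)) : Rf v (Rf v x) = x :=
  Submodule.reflection_reflection _ _

theorem Rf_smul {D : ℕ} (v : EuclideanSpace ℝ (Fin D)) {a : ℝ} (ha : a ≠ 0) :
    Rf (a • v) = Rf v := by
  unfold Rf
  congr 2
  exact Submodule.span_singleton_smul_eq (IsUnit.mk0 a ha) v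

theorem Rf_zero {D : ℕ} : Rf (0 : EuclideanSpace ℝ (Fin D)) = 1 := by
  ext1 x
  rw [Rf, Submodule.reflection_orthogonal_apply, Submodule.reflection_singleton_apply]
  simp

theorem Rf_det {D : ℕ} {v : EuclideanSpace ℝ (Fin D)} (hv : v ≠ 0) :
    LinearMap.det (Rf v).toLinearEquiv.toLinearMap = -1 := by
  have h := ((ℝ ∙ v)ᗮ).det_reflection
  rw [Submodule.orthogonal_orthogonal, finrank_span_singleton hv, pow_one] at h
  exact h

theorem refl_fderiv {D : ℕ} {W : EuclideanSpace ℝ (Fin D) → EuclideanSpace ℝ (Fin D)}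
    {x : EuclideanSpace ℝ (Fin D)} {W' : EuclideanSpace ℝ (Fin D) →L[ℝ] EuclideanSpace ℝ (Fin D)}
    (hW : HasFDerivAt W W' x) (v : EuclideanSpace ℝ (Fin D)) :
    fderiv ℝ (fun y => y - (2 * inner ℝ (W y) y) • W y) x v
      = v - (2 * inner ℝ (W x) v) • W x - (2 * inner ℝ (W' v) x) • W x
        - (2 * inner ℝ (W x) x) • W' v := by
  have hin : HasFDerivAt (fun y => inner ℝ (W y) y) _ x := HasFDerivAt.inner ℝ hW (hasFDerivAt_id x)
  have h := ((hasFDerivAt_id x).fun_sub ((hin.const_mul 2).fun_smul hW)).fderiv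
  simp only [id] at h
  rw [h]
  simp [fderivInnerCLM_apply]
  module

set_option maxHeartbeats 2000000 in
theorem tw_pair_unit {D : ℕ} {r₁ r₂ c δ : ℝ} (hr1 : 0 < r₁) (hr : r₁ < r₂) (hc : 1 ≤ c)
    (hδ1 : δ < 1) (hδc : (1 + δ) ^ 2 ≤ c) (hδc' : c⁻¹ ≤ (1 - δ) ^ 2)
    (g : ℝ → ℝ) (hg : ContDiff ℝ (⊤ : ℕ∞) (fun x : EuclideanSpace ℝ (Fin D) => g ‖x‖))
    (hg0 : ∀ r, 0 ≤ r → r ≤ r₁ → g r = 0) (hg1 : ∀ r, r₂ ≤ r → g r = 1)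
    (hgd : ∀ x v : EuclideanSpace ℝ (Fin D),
        4 * Real.pi * (|fderiv ℝ (fun x : EuclideanSpace ℝ (Fin D) => g ‖x‖) x v| * ‖x‖) ≤ δ * ‖v‖)
    (u w : EuclideanSpace ℝ (Fin D)) (hu : ‖u‖ = 1) (hw : ‖w‖ = 1) :
    Tw D r₁ r₂ c (Rf u * Rf w) := by
  set a := inner ℝ w u with ha
  by_cases hb : u - a • w = 0
  · have hu' : u = a • w := sub_eq_zero.1 hb
    have ha0 : a ≠ 0 := by
      intro h; rw [h, zero_smul] at hu'; rw [hu'] at hu; simp at hu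
    have : Rf u * Rf w = 1 := by
      rw [hu', Rf_smul w ha0]
      ext1 x
      exact Rf_invol w x
    rw [this]
    exact (tw_one D r₁ r₂).mono one_pos hc
  set b := ‖u - a • w‖ with hbdef
  have hb0 : 0 < b := norm_pos_iff.2 hb
  have hww : inner ℝ w w = (1 : ℝ) := by rw [real_inner_self_eq_norm_sq, hw]; norm_num
  have huu : inner ℝ u u = (1 : ℝ) := by rw [real_inner_self_eq_norm_sq, hu]; norm_num
  have hab : a ^ 2 + b ^ 2 = 1 := by
    rw [hbdef, ← real_inner_self_eq_norm_sq]
    simp only [inner_sub_left, inner_sub_right, real_inner_smul_left, real_inner_smul_right,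
      hww, huu, real_inner_comm u w]
    rw [real_inner_comm w u, ← ha]
    ring
  set w' := b⁻¹ • (u - a • w) with hw'def
  have hw' : ‖w'‖ = 1 := by
    rw [hw'def, norm_smul, ← hbdef, norm_inv, Real.norm_eq_abs, abs_of_pos hb0]
    field_simp
  have hort : inner ℝ w w' = (0 : ℝ) := by
    rw [hw'def, real_inner_smul_right, inner_sub_right, real_inner_smul_right, hww, ← ha]; ring
  have hort' : inner ℝ w' w = (0 : ℝ) := by rw [real_inner_comm]; exact hort
  have huw : u = a • w + b • w' := by
    rw [hw'def, smul_smul, mul_inv_cancel₀ hb0.ne', one_smul]; abel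
  set θ := Real.arccos a with hθ
  have hcosθ : Real.cos θ = a := Real.cos_arccos (by nlinarith) (by nlinarith)
  have hsinθ : Real.sin θ = b := by
    rw [hθ, Real.sin_arccos, show 1 - a ^ 2 = b ^ 2 by linarith, Real.sqrt_sq hb0.le]
  have hθ0 : 0 ≤ θ := Real.arccos_nonneg a
  have hθπ : θ ≤ Real.pi := Real.arccos_le_pi a
  -- the path on the sphere
  let p : ℝ → EuclideanSpace ℝ (Fin D) := fun t => Real.cos t • w + Real.sin t • w'
  let q : ℝ → EuclideanSpace ℝ (Fin D) := fun t => (-Real.sin t) • w + Real.cos t • w'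
  have hw'w' : inner ℝ w' w' = (1 : ℝ) := by rw [real_inner_self_eq_norm_sq, hw']; norm_num
  have hp : ∀ t, ‖p t‖ = 1 := by
    intro t
    have : ‖p t‖ ^ 2 = 1 := by
      rw [← real_inner_self_eq_norm_sq]
      simp only [p, inner_add_left, inner_add_right, real_inner_smul_left, real_inner_smul_right,
        hww, hw'w', hort, hort']
      nlinarith [Real.sin_sq_add_cos_sq t]
    exact (pow_eq_one_iff_of_nonneg (norm_nonneg (p t)) two_ne_zero).1 this
  have hq : ∀ t, ‖q t‖ = 1 := by
    intro t
    have : ‖q t‖ ^ 2 = 1 := by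
      rw [← real_inner_self_eq_norm_sq]
      simp only [q, inner_add_left, inner_add_right, real_inner_smul_left, real_inner_smul_right,
        hww, hw'w', hort, hort']
      nlinarith [Real.sin_sq_add_cos_sq t]
    exact (pow_eq_one_iff_of_nonneg (norm_nonneg (q t)) two_ne_zero).1 this
  have hpc : ContDiff ℝ (⊤ : ℕ∞) p :=
    (Real.contDiff_cos.smul contDiff_const).add (Real.contDiff_sin.smul contDiff_const)
  have hpd : ∀ t, HasDerivAt p (q t) t := fun t =>
    ((Real.hasDerivAt_cos t).smul_const w).add ((Real.hasDerivAt_sin t).smul_const w')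
  have hp0 : p 0 = w := by simp [p]
  have hpθ : p θ = u := by simp only [p, hcosθ, hsinθ]; exact huw.symm
  let W : EuclideanSpace ℝ (Fin D) → EuclideanSpace ℝ (Fin D) := fun x => p (θ * g ‖x‖)
  have hW : ContDiff ℝ (⊤ : ℕ∞) W := hpc.comp (contDiff_const.mul hg)
  have hW1 : ∀ x, ‖W x‖ = 1 := fun x => hp _
  have hWn : ∀ x y, ‖x‖ = ‖y‖ → W x = W y := fun x y h => by simp only [W, h]
  let Φ₀ : EuclideanSpace ℝ (Fin D) → EuclideanSpace ℝ (Fin D) :=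
    fun x => x - (2 * inner ℝ (W x) x) • W x
  have hΦ₀R : ∀ x, Φ₀ x = Rf (W x) x := fun x => (Rf_apply (hW1 x) x).symm
  have hΦ₀ : ContDiff ℝ (⊤ : ℕ∞) Φ₀ :=
    contDiff_id.sub ((contDiff_const.mul (hW.inner ℝ contDiff_id)).smul hW)
  have hRfc : ContDiff ℝ (⊤ : ℕ∞) (Rf u) := (Rf u).contDiff
  have hΦ₀n : ∀ x, ‖Φ₀ x‖ = ‖x‖ := fun x => by rw [hΦ₀R]; exact (Rf (W x)).norm_map x
  have hΦ₀i : ∀ x, Φ₀ (Φ₀ x) = x := fun x => by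
    rw [hΦ₀R (Φ₀ x), hWn _ _ (hΦ₀n x), hΦ₀R, Rf_invol]
  refine ⟨fun x => Rf u (Φ₀ x), fun x => Φ₀ (Rf u x), hRfc.comp hΦ₀, hΦ₀.comp hRfc,
    fun x => by simp only [Rf_invol, hΦ₀i], fun x => by simp only [Rf_invol, hΦ₀i],
    fun x => by rw [LinearIsometryEquiv.norm_map, hΦ₀n], fun x v => ?_, fun x hx => ?_,
    fun x hx => ?_⟩
  · -- derivative estimate
    set G' := fderiv ℝ (fun x : EuclideanSpace ℝ (Fin D) => g ‖x‖) x with hG'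
    have hgx : HasFDerivAt (fun x : EuclideanSpace ℝ (Fin D) => θ * g ‖x‖) (θ • G') x :=
      ((hg.differentiable (by simp) x).hasFDerivAt).const_mul θ
    have hWx := (hpd (θ * g ‖x‖)).hasFDerivAt.comp x hgx
    set Q := q (θ * g ‖x‖) with hQ
    have hQ1 : ‖Q‖ = 1 := hq _
    have hΦd : HasFDerivAt (fun x => Rf u (Φ₀ x))
        (((Rf u).toContinuousLinearEquiv : _ →L[ℝ] _).comp (fderiv ℝ Φ₀ x)) x :=
      (Rf u).toContinuousLinearEquiv.hasFDerivAt.comp x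
        (hΦ₀.differentiable (by simp) x).hasFDerivAt
    have hval : fderiv ℝ (fun x => Rf u (Φ₀ x)) x v
        = Rf u (Rf (W x) v - (2 * (θ * G' v)) • (inner ℝ Q x • W x + inner ℝ (W x) x • Q)) := by
      rw [hΦd.fderiv, ContinuousLinearMap.comp_apply]
      refine congrArg (Rf u) ?_
      have hWx' : HasFDerivAt W ((θ • G').smulRight Q) x := by
        refine hWx.congr_fderiv ?_
        ext1 z
        rfl
      have h3 : ((θ • G').smulRight Q) v = (θ * G' v) • Q := rfl
      have h4 : fderiv ℝ Φ₀ x v = _ := refl_fderiv hWx' v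
      rw [h4, h3, Rf_apply (hW1 x), real_inner_smul_left]
      module
    have hnorm : ‖fderiv ℝ (fun x => Rf u (Φ₀ x)) x v‖
        = ‖Rf (W x) v - (2 * (θ * G' v)) • (inner ℝ Q x • W x + inner ℝ (W x) x • Q)‖ := by
      rw [hval, LinearIsometryEquiv.norm_map]
    set e := (2 * (θ * G' v)) • (inner ℝ Q x • W x + inner ℝ (W x) x • Q) with he
    have heb : ‖e‖ ≤ δ * ‖v‖ := by
      have h1 : ‖inner ℝ Q x • W x + inner ℝ (W x) x • Q‖ ≤ 2 * ‖x‖ := by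
        refine (norm_add_le _ _).trans ?_
        rw [norm_smul, norm_smul, hW1, hQ1]
        have i1 := norm_inner_le_norm (𝕜 := ℝ) Q x
        have i2 := norm_inner_le_norm (𝕜 := ℝ) (W x) x
        rw [hQ1] at i1
        rw [hW1] at i2
        linarith
      rw [he, norm_smul, Real.norm_eq_abs, abs_mul, abs_mul, abs_of_nonneg hθ0, abs_two]
      calc _ ≤ 2 * (Real.pi * |G' v|) * (2 * ‖x‖) := by gcongr
        _ = 4 * Real.pi * (|G' v| * ‖x‖) := by ring
        _ ≤ _ := hgd x v
    have hlo : (1 - δ) * ‖v‖ ≤ ‖Rf (W x) v - e‖ := by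
      have := norm_sub_norm_le (Rf (W x) v) e
      rw [LinearIsometryEquiv.norm_map] at this
      linarith
    have hhi : ‖Rf (W x) v - e‖ ≤ (1 + δ) * ‖v‖ := by
      have := norm_sub_le (Rf (W x) v) e
      rw [LinearIsometryEquiv.norm_map] at this
      linarith
    rw [hnorm]
    constructor
    · calc c⁻¹ * ‖v‖ ^ 2 ≤ (1 - δ) ^ 2 * ‖v‖ ^ 2 := by gcongr
        _ = ((1 - δ) * ‖v‖) ^ 2 := by ring
        _ ≤ _ := by
          have : 0 ≤ (1 - δ) * ‖v‖ := mul_nonneg (by linarith) (norm_nonneg _)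
          gcongr
    · calc _ ≤ ((1 + δ) * ‖v‖) ^ 2 := by gcongr
        _ = (1 + δ) ^ 2 * ‖v‖ ^ 2 := by ring
        _ ≤ _ := by gcongr
  · have : W x = w := by simp only [W, hg0 _ (norm_nonneg x) hx, mul_zero, hp0]
    simp only [hΦ₀R, this]
    rfl
  · have : W x = u := by simp only [W, hg1 _ hx, mul_one, hpθ]
    simp only [hΦ₀R, this, Rf_invol]

theorem Rf_normalize {D : ℕ} {v : EuclideanSpace ℝ (Fin D)} (hv : v ≠ 0) :
    ∃ u : EuclideanSpace ℝ (Fin D), ‖u‖ = 1 ∧ Rf v = Rf u := by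
  have h : ‖v‖ ≠ 0 := norm_ne_zero_iff.2 hv
  refine ⟨‖v‖⁻¹ • v, ?_, (Rf_smul v (inv_ne_zero h)).symm⟩
  rw [norm_smul, norm_inv, norm_norm, inv_mul_cancel₀ h]

theorem tw_list {D : ℕ} {r₁ r₂ c : ℝ} (hc : 1 ≤ c)
    (hpair : ∀ u w : EuclideanSpace ℝ (Fin D), ‖u‖ = 1 → ‖w‖ = 1 → Tw D r₁ r₂ c (Rf u * Rf w)) :
    ∀ l : List (EuclideanSpace ℝ (Fin D)), (∀ v ∈ l, v ≠ 0) → Even l.length →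
      Tw D r₁ r₂ (c ^ l.length) (l.map Rf).prod
  | [], _, _ => by simpa using tw_one D r₁ r₂
  | [_], _, h => by simp at h
  | u :: w :: l, h, he => by
    have ih := tw_list hc hpair l (fun v hv => h v (by simp [hv]))
      (by simpa [Nat.even_add_one] using he)
    obtain ⟨u', hu', hu⟩ := Rf_normalize (h u (by simp))
    obtain ⟨w', hw', hw⟩ := Rf_normalize (h w (by simp))
    have h0 : 0 < c := by linarith
    have := (hpair u' w' hu' hw').mul ih h0
    rw [← hu, ← hw] at this
    have h2 := this.mono (c' := c ^ (u :: w :: l).length) (by positivity) (by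
      rw [← pow_succ']
      exact pow_le_pow_right₀ hc (by simp))
    simpa [mul_assoc] using h2

theorem list_filter_Rf {D : ℕ} (l : List (EuclideanSpace ℝ (Fin D))) :
    ∃ l' : List (EuclideanSpace ℝ (Fin D)), (∀ v ∈ l', v ≠ 0) ∧ l'.length ≤ l.length ∧
      (l'.map Rf).prod = (l.map Rf).prod := by
  induction l with
  | nil => exact ⟨[], by simp, le_rfl, rfl⟩
  | cons a l ih =>
    obtain ⟨l', h1, h2, h3⟩ := ih
    by_cases ha : a = 0
    · exact ⟨l', h1, h2.trans (by simp), by simp [ha, Rf_zero, h3]⟩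
    · exact ⟨a :: l', by simpa [ha] using h1, by simpa using h2, by simp [h3]⟩

theorem list_det_Rf {D : ℕ} (l : List (EuclideanSpace ℝ (Fin D))) (h : ∀ v ∈ l, v ≠ 0) :
    LinearMap.det ((l.map Rf).prod).toLinearEquiv.toLinearMap = (-1) ^ l.length := by
  induction l with
  | nil => exact LinearMap.det_id
  | cons a l ih =>
    have h1 : LinearMap.det ((Rf a * (l.map Rf).prod)).toLinearEquiv.toLinearMap
      = LinearMap.det (Rf a).toLinearEquiv.toLinearMap
        * LinearMap.det ((l.map Rf).prod).toLinearEquiv.toLinearMap := LinearMap.det_comp _ _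
    rw [List.map_cons, List.prod_cons, h1, ih (fun v hv => h v (by simp [hv])),
      Rf_det (h a (by simp)), List.length_cons, pow_succ']

theorem exists_isometry {D : ℕ} (Θ : Matrix (Fin D) (Fin D) ℝ)
    (hΘ : Θ ∈ Matrix.orthogonalGroup (Fin D) ℝ) :
    ∃ φ : EuclideanSpace ℝ (Fin D) ≃ₗᵢ[ℝ] EuclideanSpace ℝ (Fin D),
      φ.toLinearEquiv.toLinearMap = Matrix.toEuclideanLin Θ := by
  have h := (Matrix.mem_orthogonalGroup_iff' _ _).1 hΘ
  have hin : ∀ x y, inner ℝ (Matrix.toEuclideanLin Θ x) (Matrix.toEuclideanLin Θ y)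
      = inner ℝ x y := by
    intro x y
    rw [← LinearMap.adjoint_inner_right, ← Matrix.toEuclideanLin_conjTranspose_eq_adjoint]
    congr 1
    ext1
    simp only [Matrix.ofLp_toLpLin, Matrix.toLin'_apply, Matrix.mulVec_mulVec]
    rw [Matrix.conjTranspose_eq_transpose_of_trivial, h, Matrix.one_mulVec]
  refine ⟨((Matrix.toEuclideanLin Θ).isometryOfInner hin).toLinearIsometryEquiv rfl, ?_⟩
  ext1 x
  rfl

/-- Slow twists. For small `ε` there is `η > 0` such that for every
`Θ ∈ SO(D)` and radii `0 < r₁ ≤ η r₂` there is an `ε`-distorted diffeomorphism equal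
to `Θ` on `{|x| ≤ r₁}` and to the identity on `{|x| ≥ r₂}`. -/
theorem slow_twist_interpolation
    (D : ℕ) (hD : 2 ≤ D) :
    ∃ ε₀ > (0 : ℝ), ∀ ε : ℝ, 0 < ε → ε < ε₀ →
      ∃ η > (0 : ℝ), ∀ Θ : Matrix (Fin D) (Fin D) ℝ,
        Θ ∈ Matrix.orthogonalGroup (Fin D) ℝ → Θ.det = 1 →
        ∀ r₁ r₂ : ℝ, 0 < r₁ → r₁ ≤ η * r₂ →
          ∃ Φ : EuclideanSpace ℝ (Fin D) → EuclideanSpace ℝ (Fin D),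
            IsDistorted D ε Φ ∧
            (∀ x, ‖x‖ ≤ r₁ → Φ x = Matrix.toEuclideanLin Θ x) ∧
            (∀ x, r₂ ≤ ‖x‖ → Φ x = x) := by
  refine ⟨1, one_pos, fun ε hε _ => ?_⟩
  obtain ⟨K, hK, hcut⟩ := slow_cutoff D
  obtain ⟨c, hc1, hcD⟩ : ∃ c : ℝ, 1 < c ∧ c ^ D = 1 + ε := by
    refine ⟨(1 + ε) ^ ((D : ℝ)⁻¹), Real.one_lt_rpow (by linarith) (by positivity), ?_⟩
    exact Real.rpow_inv_natCast_pow (by linarith) (by omega)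
  obtain ⟨δ, hδ0, hδ1, hδc, hδc'⟩ : ∃ δ : ℝ, 0 < δ ∧ δ < 1 ∧ (1 + δ) ^ 2 ≤ c ∧
      c⁻¹ ≤ (1 - δ) ^ 2 := by
    have h1 : ∀ᶠ δ : ℝ in nhds 0, (1 + δ) ^ 2 < c :=
      (Continuous.tendsto (f := fun δ : ℝ => (1 + δ) ^ 2) (by fun_prop) 0).eventually_lt_const
        (by simpa using hc1)
    have h2 : ∀ᶠ δ : ℝ in nhds 0, c⁻¹ < (1 - δ) ^ 2 :=
      (Continuous.tendsto (f := fun δ : ℝ => (1 - δ) ^ 2) (by fun_prop) 0).eventually_const_lt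
        (by simpa using inv_lt_one_of_one_lt₀ hc1)
    have h3 : ∀ᶠ δ : ℝ in nhds 0, δ < 1 := gt_mem_nhds one_pos
    have h4 := ((h1.and (h2.and h3)).filter_mono
      (nhdsWithin_le_nhds (s := Set.Ioi (0 : ℝ)))).and self_mem_nhdsWithin
    obtain ⟨δ, ⟨a, b, d⟩, e⟩ := h4.exists
    exact ⟨δ, e, d, a.le, b.le⟩
  set M := 4 * Real.pi * K / δ with hM
  have hpi := Real.pi_pos
  have hM0 : 0 < M := by positivity
  refine ⟨Real.exp (-M), Real.exp_pos _, fun Θ hΘ hdet r₁ r₂ hr1 hr => ?_⟩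
  have hr2 : 0 < r₂ := by
    by_contra hcon
    have := mul_nonpos_of_nonneg_of_nonpos (Real.exp_pos (-M)).le (not_lt.1 hcon)
    linarith
  have hratio : Real.exp M ≤ r₂ / r₁ := by
    rw [le_div_iff₀ hr1]
    calc Real.exp M * r₁ ≤ Real.exp M * (Real.exp (-M) * r₂) := by gcongr
      _ = r₂ := by rw [← mul_assoc, ← Real.exp_add]; simp
  have hlog : M ≤ Real.log (r₂ / r₁) := by
    rwa [Real.le_log_iff_exp_le (by positivity)]
  have hr12 : r₁ < r₂ := by
    rw [← one_lt_div hr1]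
    exact lt_of_lt_of_le (Real.one_lt_exp_iff.2 hM0) hratio
  obtain ⟨g, hg, hg0, hg1, hgd⟩ := hcut r₁ r₂ hr1 hr12
  have hpair : ∀ u w : EuclideanSpace ℝ (Fin D), ‖u‖ = 1 → ‖w‖ = 1 →
      Tw D r₁ r₂ c (Rf u * Rf w) := by
    refine tw_pair_unit hr1 hr12 hc1.le hδ1 hδc hδc' g hg hg0 hg1 fun x v => ?_
    calc _ ≤ 4 * Real.pi * (K / Real.log (r₂ / r₁) * ‖v‖) := by
          exact mul_le_mul_of_nonneg_left (hgd x v) (by positivity)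
      _ ≤ 4 * Real.pi * (K / M * ‖v‖) := by gcongr
      _ = δ * ‖v‖ := by rw [hM]; field_simp
  obtain ⟨φ, hφ⟩ := exists_isometry Θ hΘ
  obtain ⟨l, hl, hφl⟩ := φ.reflections_generate_dim
  have hφl' : φ = (l.map Rf).prod := hφl
  obtain ⟨l', hne, hlen, hprod⟩ := list_filter_Rf l
  rw [finrank_euclideanSpace_fin] at hl
  rw [← hprod] at hφl'
  have heven : Even l'.length := by
    have h := list_det_Rf l' hne
    rw [← hφl', hφ, LinearMap.det_toLpLin, hdet] at h
    by_contra hodd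
    rw [Nat.not_even_iff_odd] at hodd
    rw [hodd.neg_one_pow] at h
    norm_num at h
  have htw := tw_list hc1.le hpair l' hne heven
  rw [← hφl'] at htw
  have hc0 : 0 < c := by linarith
  obtain ⟨Φ, Ψ, h1, h2, h3, h4, h5, h6, h7, h8⟩ := htw.mono (c' := 1 + ε) (by positivity)
    (hcD ▸ pow_le_pow_right₀ hc1.le (hlen.trans hl))
  have hbij : Function.Bijective Φ :=
    ⟨Function.LeftInverse.injective h3, Function.RightInverse.surjective h4⟩
  refine ⟨Φ, ⟨hbij, h1, ?_, h6⟩, fun x hx => ?_, h8⟩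
  · have : Function.invFun Φ = Ψ := by
      funext y
      apply hbij.1
      rw [h4, Function.invFun_eq (hbij.2 y)]
    rwa [this]
  · rw [h7 x hx, ← hφ]; rfl
end

section
/- Let D ≥ 2 and let ε > 0 be small enough (less than a constant depending only on D). Then there exist η > 0 and c > 0 depending on ε and D such that the following holds: let Φ_1 : x ↦ Tx + x_0 be a proper Euclidean motion on ℝ^D (T ∈ SO(D)), and let r_1, r_2 > 0 satisfy 0 < r_1 ≤ η r_2 and |x_0| ≤ c ε r_1. Then there exists an ε-distorted diffeomorphism Φ_2 : ℝ^D → ℝ^D such that Φ_2(x) = Φ_1(x) for |x| ≤ r_1 and Φ_2(x) = x for |x| ≥ r_2. -/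
open Filter Topology

section PathPart

variable {E : Type*} [NormedAddCommGroup E] [InnerProductSpace ℝ E] [FiniteDimensional ℝ E]

def GoodPath (φ : E ≃ₗᵢ[ℝ] E) (C : ℝ) : Prop :=
  LinearMap.det φ.toLinearEquiv.toLinearMap = 1 ∧ ∃ γ : ℝ → E →L[ℝ] E, ContDiff ℝ (⊤ : ℕ∞) γ ∧ γ 0 = 1 ∧
    (∀ x, γ 1 x = φ x) ∧ (∀ t x, ‖γ t x‖ = ‖x‖) ∧ ∀ t, ‖deriv γ t‖ ≤ C

theorem goodPath_one : GoodPath (1 : E ≃ₗᵢ[ℝ] E) 0 := by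
  refine ⟨?_, fun _ => 1, contDiff_const, rfl, fun x => rfl, fun t x => rfl, fun t => by simp⟩
  exact LinearMap.det_id

theorem GoodPath.mono {φ : E ≃ₗᵢ[ℝ] E} {C C' : ℝ} (h : GoodPath φ C) (hC : C ≤ C') :
    GoodPath φ C' := by
  obtain ⟨h0, γ, h1, h2, h3, h4, h5⟩ := h
  exact ⟨h0, γ, h1, h2, h3, h4, fun t => (h5 t).trans hC⟩

theorem GoodPath.mul {φ₁ φ₂ : E ≃ₗᵢ[ℝ] E} {C₁ C₂ : ℝ} (h : GoodPath φ₁ C₁) (h' : GoodPath φ₂ C₂) :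
    GoodPath (φ₁ * φ₂) (C₁ + C₂) := by
  obtain ⟨h0, γ, h1, h2, h3, h4, h5⟩ := h
  obtain ⟨k0, δ, k1, k2, k3, k4, k5⟩ := h'
  refine ⟨?_, fun t => γ t * δ t, ContDiff.clm_comp h1 k1, by simp [h2, k2], fun x => ?_, fun t x => ?_,
    fun t => ?_⟩
  · have : (φ₁ * φ₂).toLinearEquiv.toLinearMap
      = φ₁.toLinearEquiv.toLinearMap ∘ₗ φ₂.toLinearEquiv.toLinearMap := rfl
    rw [this, LinearMap.det_comp, h0, k0, one_mul]
  · simp [h3, k3]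
  · simp [h4, k4]
  · have d1 := ((h1.differentiable (by simp)) t).hasDerivAt
    have d2 := ((k1.differentiable (by simp)) t).hasDerivAt
    have d3 : HasDerivAt (fun t => γ t * δ t) _ t := d1.mul d2
    rw [d3.deriv]
    have n1 : ‖γ t‖ ≤ 1 := ContinuousLinearMap.opNorm_le_bound _ zero_le_one (fun x => by simp [h4])
    have n2 : ‖δ t‖ ≤ 1 := ContinuousLinearMap.opNorm_le_bound _ zero_le_one (fun x => by simp [k4])
    refine (norm_add_le _ _).trans (add_le_add ?_ ?_)
    · refine (norm_mul_le _ _).trans ?_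
      nlinarith [h5 t, norm_nonneg (deriv γ t), norm_nonneg (δ t)]
    · refine (norm_mul_le _ _).trans ?_
      nlinarith [k5 t, norm_nonneg (deriv δ t), norm_nonneg (γ t)]

noncomputable abbrev rfl1 (v : E) : E ≃ₗᵢ[ℝ] E := (ℝ ∙ v)ᗮ.reflection

theorem rfl1_unit {v : E} (hv : ‖v‖ = 1) (x : E) :
    rfl1 v x = x - (2 * inner ℝ v x) • v := by
  rw [rfl1, Submodule.reflection_orthogonal_apply, Submodule.reflection_singleton_apply]
  simp [hv, mul_smul, two_smul]

theorem rfl1_smul {v : E} {c : ℝ} (hc : c ≠ 0) : rfl1 (c • v) = rfl1 v := by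
  unfold rfl1
  have : (ℝ ∙ (c • v)) = (ℝ ∙ v) := Submodule.span_singleton_smul_eq (IsUnit.mk0 c hc) v
  simp only [this]

theorem rfl1_zero : rfl1 (0 : E) = 1 := by
  ext x
  rw [rfl1, Submodule.reflection_orthogonal_apply, Submodule.reflection_singleton_apply]
  simp

theorem det_rfl1 {v : E} (hv : v ≠ 0) :
    LinearMap.det (rfl1 v).toLinearEquiv.toLinearMap = -1 := by
  have := Submodule.det_reflection (𝕜 := ℝ) (E := E) (ℝ ∙ v)ᗮ
  rw [Submodule.orthogonal_orthogonal, finrank_span_singleton hv, pow_one] at this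
  exact this

theorem rfl1_mul_self (v : E) : rfl1 v * rfl1 v = 1 := Submodule.reflection_mul_reflection _

theorem goodPath_rfl_unit {u v : E} (hu : ‖u‖ = 1) (hv : ‖v‖ = 1) :
    GoodPath (rfl1 u * rfl1 v) (4 * Real.pi) := by
  have hpi := Real.pi_pos
  set s : ℝ := inner ℝ v u with hs
  by_cases he : u - s • v = 0
  · have hu' : u = s • v := sub_eq_zero.1 he
    have hs0 : s ≠ 0 := by
      rintro h
      rw [h, zero_smul] at hu'
      simp [hu'] at hu
    rw [hu', rfl1_smul hs0, rfl1_mul_self]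
    exact goodPath_one.mono (by positivity)
  set e' := u - s • v with he'
  have hn0 : 0 < ‖e'‖ := norm_pos_iff.2 he
  have hvv : inner ℝ v v = (1 : ℝ) := by rw [real_inner_self_eq_norm_sq, hv]; norm_num
  have huu : inner ℝ u u = (1 : ℝ) := by rw [real_inner_self_eq_norm_sq, hu]; norm_num
  have hve' : inner ℝ v e' = (0 : ℝ) := by
    rw [he', inner_sub_right, inner_smul_right, hvv]; simp [hs]
  have hee' : ‖e'‖ ^ 2 = 1 - s ^ 2 := by
    rw [← real_inner_self_eq_norm_sq]
    conv_lhs => rw [he']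
    have hcomm : inner ℝ u v = s := real_inner_comm _ _
    simp only [inner_sub_left, inner_sub_right, inner_smul_left, inner_smul_right, hvv, huu,
      hcomm, ← hs, conj_trivial]
    ring
  set e := ‖e'‖⁻¹ • e' with hedef
  have hve : inner ℝ v e = (0 : ℝ) := by rw [hedef, inner_smul_right, hve', mul_zero]
  have hen : ‖e‖ = 1 := by rw [hedef, norm_smul]; simp [hn0.ne']
  set θ := Real.arccos s with hθ
  have hs1 : s ≤ 1 := by nlinarith [sq_nonneg ‖e'‖]
  have hs2 : -1 ≤ s := by nlinarith [sq_nonneg ‖e'‖]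
  have hcos : Real.cos θ = s := Real.cos_arccos hs2 hs1
  have hsin : Real.sin θ = ‖e'‖ := by
    rw [hθ, Real.sin_arccos, ← hee', Real.sqrt_sq hn0.le]
  have hθ0 : 0 ≤ θ := Real.arccos_nonneg _
  have hθ1 : θ ≤ Real.pi := Real.arccos_le_pi _
  let w : ℝ → E := fun t => Real.cos (θ * t) • v + Real.sin (θ * t) • e
  have hnorm : ∀ a b : ℝ, ‖a • v + b • e‖ ^ 2 = a ^ 2 + b ^ 2 := by
    intro a b
    rw [norm_add_sq_real, norm_smul, norm_smul, hv, hen, inner_smul_left, inner_smul_right, hve]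
    simp
  have hw : ∀ t, ‖w t‖ = 1 := by
    intro t
    have := hnorm (Real.cos (θ * t)) (Real.sin (θ * t))
    rw [Real.cos_sq_add_sin_sq] at this
    exact (pow_eq_one_iff_of_nonneg (norm_nonneg _) two_ne_zero).1 this
  have hw0 : w 0 = v := by simp [w]
  have hw1 : w 1 = u := by
    simp only [w, mul_one, hcos, hsin]
    rw [hedef, smul_smul, mul_inv_cancel₀ hn0.ne', he']; simp
  let w' : ℝ → E := fun t => (-Real.sin (θ * t) * θ) • v + (Real.cos (θ * t) * θ) • e
  have hw' : ∀ t, ‖w' t‖ = θ := by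
    intro t
    have := hnorm (-Real.sin (θ * t) * θ) (Real.cos (θ * t) * θ)
    have h2 : (-Real.sin (θ * t) * θ) ^ 2 + (Real.cos (θ * t) * θ) ^ 2 = θ ^ 2 := by
      linear_combination θ ^ 2 * Real.sin_sq_add_cos_sq (θ * t)
    rw [h2] at this
    exact (pow_left_inj₀ (norm_nonneg _) hθ0 two_ne_zero).1 this
  have hwd : ∀ t, HasDerivAt w (w' t) t := by
    intro t
    have h0 : HasDerivAt (fun t => θ * t) θ t := by simpa using (hasDerivAt_id t).const_mul θ
    exact (h0.cos.smul_const v).add (h0.sin.smul_const e)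
  have hwc : ContDiff ℝ (⊤ : ℕ∞) w := by
    refine ContDiff.add (ContDiff.smul ?_ contDiff_const) (ContDiff.smul ?_ contDiff_const)
    · exact Real.contDiff_cos.comp (contDiff_const.mul contDiff_id)
    · exact Real.contDiff_sin.comp (contDiff_const.mul contDiff_id)
  let B : E →L[ℝ] E →L[ℝ] E →L[ℝ] E :=
    (ContinuousLinearMap.smulRightL ℝ E E).comp (innerSL ℝ (E := E))
  have hB : ∀ a b x : E, B a b x = (inner ℝ a x : ℝ) • b := fun a b x => rfl
  let ρ : ℝ → E →L[ℝ] E := fun t => 1 - (2 : ℝ) • B (w t) (w t)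
  have hρ : ∀ t x, ρ t x = rfl1 (w t) x := by
    intro t x
    rw [rfl1_unit (hw t)]
    simp [ρ, hB, mul_smul]
  have hBc : ContDiff ℝ (⊤ : ℕ∞) (fun t => B (w t)) :=
    
    by
    have hB0 := ContinuousLinearMap.contDiff (𝕜 := ℝ) (n := ((⊤ : ℕ∞) : WithTop ℕ∞))
      (E := E) (F := E →L[ℝ] E →L[ℝ] E) B
    exact hB0.comp hwc
  have hρc : ContDiff ℝ (⊤ : ℕ∞) ρ :=
    contDiff_const.sub (ContDiff.const_smul (2 : ℝ) (hBc.clm_apply hwc))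
  have hρd : ∀ t, HasDerivAt ρ (-((2 : ℝ) • (B (w' t) (w t) + B (w t) (w' t)))) t := by
    intro t
    have h0 := ContinuousLinearMap.hasFDerivAt (𝕜 := ℝ)
      (E := E) (F := E →L[ℝ] E →L[ℝ] E) B (x := w t)
    have h1 : HasDerivAt (fun t => B (w t)) (B (w' t)) t :=
      HasFDerivAt.comp_hasDerivAt (F := E) (E := E →L[ℝ] E →L[ℝ] E) t h0 (hwd t)
    have h2 := (h1.clm_apply (hwd t)).const_smul (2 : ℝ)
    exact h2.const_sub 1
  have hBn : ∀ a b : E, ‖B a b‖ ≤ ‖a‖ * ‖b‖ := by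
    intro a b
    refine ContinuousLinearMap.opNorm_le_bound _ (by positivity) fun x => ?_
    rw [hB, norm_smul]
    nlinarith [norm_inner_le_norm (𝕜 := ℝ) a x, norm_nonneg b]
  have hρn : ∀ t, ‖deriv ρ t‖ ≤ 4 * Real.pi := by
    intro t
    rw [(hρd t).deriv, norm_neg, norm_smul]
    have h1 := hBn (w' t) (w t)
    have h2 := hBn (w t) (w' t)
    rw [hw, hw'] at h1 h2
    have h3 := norm_add_le (B (w' t) (w t)) (B (w t) (w' t))
    simp only [Real.norm_ofNat]
    linarith
  refine ⟨?_, fun t => ρ t * ρ 0, ContDiff.clm_comp hρc contDiff_const, ?_, fun x => ?_,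
    fun t x => ?_, fun t => ?_⟩
  · have : (rfl1 u * rfl1 v).toLinearEquiv.toLinearMap
      = (rfl1 u).toLinearEquiv.toLinearMap ∘ₗ (rfl1 v).toLinearEquiv.toLinearMap := rfl
    rw [this, LinearMap.det_comp, det_rfl1, det_rfl1]
    · norm_num
    · rintro rfl; simp at hv
    · rintro rfl; simp at hu
  · ext x
    change ρ 0 (ρ 0 x) = x
    rw [hρ, hρ]
    exact Submodule.reflection_reflection _ _
  · change ρ 1 (ρ 0 x) = _
    rw [hρ, hρ, hw0, hw1]
    rfl
  · change ‖ρ t (ρ 0 x)‖ = _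
    rw [hρ, hρ, LinearIsometryEquiv.norm_map, LinearIsometryEquiv.norm_map]
  · have d1 := (((hρc.differentiable (by simp)) t).hasDerivAt).mul_const (ρ 0)
    rw [d1.deriv]
    have n2 : ‖ρ 0‖ ≤ 1 := ContinuousLinearMap.opNorm_le_bound _ zero_le_one
      (fun x => by rw [hρ]; simp)
    refine (norm_mul_le _ _).trans ?_
    nlinarith [hρn t, norm_nonneg (deriv ρ t), norm_nonneg (ρ 0)]

theorem goodPath_rfl {u v : E} (hu : u ≠ 0) (hv : v ≠ 0) :
    GoodPath (rfl1 u * rfl1 v) (4 * Real.pi) := by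
  have hu' := norm_ne_zero_iff.2 hu
  have hv' := norm_ne_zero_iff.2 hv
  rw [← rfl1_smul (v := u) (inv_ne_zero hu'), ← rfl1_smul (v := v) (inv_ne_zero hv')]
  apply goodPath_rfl_unit
  · rw [norm_smul]; simp [hu]
  · rw [norm_smul]; simp [hv]

theorem goodPath_list (l : List E) :
    GoodPath (l.map rfl1).prod (4 * Real.pi * l.length) ∨
    ∃ v ≠ 0, GoodPath (rfl1 v * (l.map rfl1).prod) (4 * Real.pi * l.length) := by
  have hpi := Real.pi_pos
  induction l with
  | nil => left; simpa using goodPath_one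
  | cons u l ih =>
    have hle : 4 * Real.pi * (l.length : ℝ) ≤ 4 * Real.pi * ((u :: l).length : ℝ) := by
      push_cast [List.length_cons]; nlinarith
    by_cases hu : u = 0
    · subst hu
      simp only [List.map_cons, List.prod_cons, rfl1_zero, one_mul]
      rcases ih with h | ⟨v, hv, h⟩
      · exact .inl (h.mono hle)
      · exact .inr ⟨v, hv, h.mono hle⟩
    rcases ih with h | ⟨v, hv, h⟩
    · right
      refine ⟨u, hu, ?_⟩
      rw [List.map_cons, List.prod_cons, ← mul_assoc, rfl1_mul_self, one_mul]
      exact h.mono hle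
    · left
      have := (goodPath_rfl hu hv).mul h
      rw [mul_assoc, ← mul_assoc (rfl1 v), rfl1_mul_self, one_mul] at this
      rw [List.map_cons, List.prod_cons]
      refine this.mono ?_
      push_cast [List.length_cons]; linarith

theorem goodPath_of_det (φ : E ≃ₗᵢ[ℝ] E) (hφ : LinearMap.det φ.toLinearEquiv.toLinearMap = 1) :
    GoodPath φ (4 * Real.pi * Module.finrank ℝ E) := by
  have hpi := Real.pi_pos
  obtain ⟨l, hl, h⟩ := φ.reflections_generate_dim
  have hle : 4 * Real.pi * (l.length : ℝ) ≤ 4 * Real.pi * (Module.finrank ℝ E : ℝ) := by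
    have : (l.length : ℝ) ≤ Module.finrank ℝ E := by exact_mod_cast hl
    nlinarith
  have h' : φ = (l.map rfl1).prod := h
  rcases goodPath_list l with g | ⟨v, hv, g⟩
  · rw [← h'] at g; exact g.mono hle
  · rw [← h'] at g
    have h1 := g.1
    have : (rfl1 v * φ).toLinearEquiv.toLinearMap
      = (rfl1 v).toLinearEquiv.toLinearMap ∘ₗ φ.toLinearEquiv.toLinearMap := rfl
    rw [this, LinearMap.det_comp, hφ, det_rfl1 hv] at h1
    norm_num at h1

end PathPart

theorem exists_deriv_smoothTransition_bound :
    ∃ K : ℝ, 0 < K ∧ ∀ t, |deriv Real.smoothTransition t| ≤ K := by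
  have hc : Continuous (deriv Real.smoothTransition) :=
    (Real.smoothTransition.contDiff (n := 1)).continuous_deriv le_rfl
  obtain ⟨K, hK⟩ := (isCompact_Icc (a := (0:ℝ)) (b := 1)).exists_bound_of_continuousOn
    hc.continuousOn
  refine ⟨max K 1, by positivity, fun t => ?_⟩
  by_cases h0 : t < 0
  · have : Real.smoothTransition =ᶠ[𝓝 t] fun _ => 0 := by
      filter_upwards [Iio_mem_nhds h0] with s hs
      exact Real.smoothTransition.zero_of_nonpos hs.le
    rw [this.deriv_eq]; simp
  by_cases h1 : 1 < t
  · have : Real.smoothTransition =ᶠ[𝓝 t] fun _ => 1 := by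
      filter_upwards [Ioi_mem_nhds h1] with s hs
      exact Real.smoothTransition.one_of_one_le hs.le
    rw [this.deriv_eq]; simp
  · exact (hK t ⟨not_lt.1 h0, not_lt.1 h1⟩).trans (le_max_left _ _)

section Cut
variable {E : Type*} [NormedAddCommGroup E] [InnerProductSpace ℝ E]

noncomputable def cutArg (r₁ r₂ M : ℝ) (x : E) : ℝ :=
  (Real.log (r₂ ^ 2) - Real.log (‖x‖ ^ 2 + r₁ ^ 2)) / M

/-- The logarithmic cutoff. -/
theorem exists_cutoff {K : ℝ} (hK : ∀ t, |deriv Real.smoothTransition t| ≤ K)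
    {r₁ r₂ M : ℝ} (h1 : 0 < r₁) (h2 : 0 < r₂) (hM : 0 < M)
    (hr : M ≤ Real.log (r₂ ^ 2) - Real.log (2 * r₁ ^ 2)) :
    ∃ g : E → ℝ, ContDiff ℝ (⊤ : ℕ∞) g ∧ (∀ x, ‖x‖ ≤ r₁ → g x = 1) ∧ (∀ x, r₂ ≤ ‖x‖ → g x = 0) ∧
      (∀ x y, ‖x‖ = ‖y‖ → g x = g y) ∧
      (∀ x v, ‖x‖ * |fderiv ℝ g x v| ≤ 2 * K / M * ‖v‖) ∧
      (∀ x v, r₁ * |fderiv ℝ g x v| ≤ 2 * K / M * ‖v‖) := by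
  have hK0 : 0 ≤ K := (abs_nonneg _).trans (hK 0)
  have hpos : ∀ x : E, 0 < ‖x‖ ^ 2 + r₁ ^ 2 := fun x => by positivity
  have hcd : ContDiff ℝ (⊤ : ℕ∞) (cutArg r₁ r₂ M : E → ℝ) := by
    unfold cutArg
    refine ContDiff.div_const (contDiff_const.sub (ContDiff.log ?_ fun x => (hpos x).ne')) _
    exact (contDiff_norm_sq ℝ).add contDiff_const
  have hd : ∀ x v : E, fderiv ℝ (fun x => Real.smoothTransition (cutArg r₁ r₂ M x)) x v =
      deriv Real.smoothTransition (cutArg r₁ r₂ M x) *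
        (-(2 * inner ℝ x v / (‖x‖ ^ 2 + r₁ ^ 2)) / M) := by
    intro x v
    have e1 : HasFDerivAt (fun x : E => ‖x‖ ^ 2 + r₁ ^ 2) (2 • innerSL ℝ x) x :=
      ((hasStrictFDerivAt_norm_sq x).hasFDerivAt).add_const _
    have e2 := (e1.log (hpos x).ne').const_sub (Real.log (r₂ ^ 2))
    have e3 := e2.mul_const M⁻¹
    have e4 : HasDerivAt Real.smoothTransition (deriv Real.smoothTransition (cutArg r₁ r₂ M x))
        (cutArg r₁ r₂ M x) :=
      ((Real.smoothTransition.contDiff (n := 1)).differentiable (by simp) _).hasDerivAt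
    have e5 : HasFDerivAt (cutArg r₁ r₂ M : E → ℝ) _ x := e3
    have e6 : HasFDerivAt (fun x => Real.smoothTransition (cutArg r₁ r₂ M x)) _ x :=
      e4.comp_hasFDerivAt x e5
    rw [e6.fderiv]
    simp
    field_simp
  have hb : ∀ (a : ℝ) (x v : E), 0 ≤ a → a * ‖x‖ ≤ ‖x‖ ^ 2 + r₁ ^ 2 →
      a * |fderiv ℝ (fun x => Real.smoothTransition (cutArg r₁ r₂ M x)) x v| ≤ 2 * K / M * ‖v‖ := by
    intro a x v ha hax
    rw [hd, abs_mul, abs_div, abs_neg, abs_div, abs_mul, abs_of_pos (hpos x), abs_of_pos hM, abs_two]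
    have hin : a * |inner ℝ x v| / (‖x‖ ^ 2 + r₁ ^ 2) ≤ ‖v‖ := by
      rw [div_le_iff₀ (hpos x)]
      have := abs_real_inner_le_norm x v
      calc a * |inner ℝ x v| ≤ a * (‖x‖ * ‖v‖) := by gcongr
        _ = (a * ‖x‖) * ‖v‖ := by ring
        _ ≤ (‖x‖ ^ 2 + r₁ ^ 2) * ‖v‖ := by gcongr
        _ = _ := by ring
    calc _ = |deriv Real.smoothTransition (cutArg r₁ r₂ M x)| * (2 / M) *
          (a * |inner ℝ x v| / (‖x‖ ^ 2 + r₁ ^ 2)) := by ring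
      _ ≤ K * (2 / M) * ‖v‖ := by
        gcongr
        exact hK _
      _ = _ := by ring
  refine ⟨fun x => Real.smoothTransition (cutArg r₁ r₂ M x),
    Real.smoothTransition.contDiff.comp hcd, fun x hx => ?_, fun x hx => ?_, fun x y h => ?_,
    fun x v => ?_, fun x v => ?_⟩
  · apply Real.smoothTransition.one_of_one_le
    rw [cutArg, le_div_iff₀ hM, one_mul]
    refine hr.trans (sub_le_sub_left (Real.log_le_log (hpos x) ?_) _)
    have : ‖x‖ ^ 2 ≤ r₁ ^ 2 := by gcongr
    linarith
  · apply Real.smoothTransition.zero_of_nonpos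
    refine div_nonpos_of_nonpos_of_nonneg (sub_nonpos.2 (Real.log_le_log (by positivity) ?_)) hM.le
    have : r₂ ^ 2 ≤ ‖x‖ ^ 2 := by gcongr
    nlinarith
  · simp only [cutArg, h]
  · apply hb _ _ _ (norm_nonneg _); nlinarith
  · apply hb _ _ _ h1.le; nlinarith [sq_nonneg (‖x‖ - r₁), norm_nonneg x]

end Cut

section Gen
variable {E : Type*} [NormedAddCommGroup E] [InnerProductSpace ℝ E] [FiniteDimensional ℝ E]

theorem contDiff_invFun_of {Φ : E → E} (hb : Function.Bijective Φ) (hc : ContDiff ℝ (⊤ : ℕ∞) Φ)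
    (hinj : ∀ x v, fderiv ℝ Φ x v = 0 → v = 0) : ContDiff ℝ (⊤ : ℕ∞) (Function.invFun Φ) := by
  have hi : ∀ x, Function.Injective (fderiv ℝ Φ x).toLinearMap := fun x =>
    (injective_iff_map_eq_zero _).2 (hinj x)
  let f' : E → E ≃L[ℝ] E := fun x =>
    (LinearEquiv.ofInjectiveEndo (fderiv ℝ Φ x).toLinearMap (hi x)).toContinuousLinearEquiv
  have hf' : ∀ x, (f' x : E →L[ℝ] E) = fderiv ℝ Φ x := fun x => by ext v; rfl
  have hs : ∀ x, HasStrictFDerivAt Φ (f' x : E →L[ℝ] E) x := fun x => by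
    rw [hf']
    exact hc.contDiffAt.hasStrictFDerivAt (by simp)
  have hopen : IsOpenMap Φ := isOpenMap_iff_nhds_le.2 fun x => (hs x).map_nhds_eq_of_equiv.ge
  let h : E ≃ₜ E := (Equiv.ofBijective Φ hb).toHomeomorphOfContinuousOpen hc.continuous hopen
  have hsymm : Function.invFun Φ = h.symm := by
    funext y
    apply hb.1
    rw [Function.rightInverse_invFun hb.2 y]
    exact (h.apply_symm_apply y).symm
  rw [hsymm]
  exact h.contDiff_symm (f₀' := f') (fun a => (hs a).hasFDerivAt) hc

/-- twisting by a path of isometries -/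
theorem rot_part {γ : ℝ → E →L[ℝ] E} {C δ : ℝ} {g : E → ℝ} (hγ : ContDiff ℝ (⊤ : ℕ∞) γ)
    (hn : ∀ t x, ‖γ t x‖ = ‖x‖) (hC : ∀ t, ‖deriv γ t‖ ≤ C) (hC0 : 0 ≤ C)
    (hg : ContDiff ℝ (⊤ : ℕ∞) g)
    (hgn : ∀ x y, ‖x‖ = ‖y‖ → g x = g y) (hgd : ∀ x v, ‖x‖ * |fderiv ℝ g x v| ≤ δ * ‖v‖) :
    Function.Bijective (fun x => γ (g x) x) ∧ ContDiff ℝ (⊤ : ℕ∞) (fun x => γ (g x) x) ∧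
    ∀ x v, (1 - C * δ) * ‖v‖ ≤ ‖fderiv ℝ (fun x => γ (g x) x) x v‖ ∧
      ‖fderiv ℝ (fun x => γ (g x) x) x v‖ ≤ (1 + C * δ) * ‖v‖ := by
  have hinj : ∀ t, Function.Injective (γ t).toLinearMap := fun t =>
    (injective_iff_map_eq_zero _).2 fun x hx => by
      have := hn t x
      rw [show γ t x = 0 from hx, norm_zero] at this
      exact norm_eq_zero.1 this.symm
  refine ⟨⟨fun x y h => ?_, fun y => ?_⟩, (hγ.comp hg).clm_apply contDiff_id, fun x v => ?_⟩
  · have h : γ (g x) x = γ (g y) y := h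
    have h1 : ‖x‖ = ‖y‖ := by rw [← hn (g x) x, h, hn]
    rw [hgn x y h1] at h
    exact hinj _ h
  · obtain ⟨x, hx⟩ := (LinearMap.injective_iff_surjective.1 (hinj (g y))) y
    have hx : γ (g y) x = y := hx
    refine ⟨x, ?_⟩
    have h1 : ‖x‖ = ‖y‖ := by rw [← hn (g y) x, hx]
    simp only [hgn x y h1, hx]
  · have d1 : HasFDerivAt (fun x => γ (g x)) ((fderiv ℝ γ (g x)).comp (fderiv ℝ g x)) x :=
      ((hγ.differentiable (by simp) (g x)).hasFDerivAt).comp x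
        (hg.differentiable (by simp) x).hasFDerivAt
    have d2 : HasFDerivAt (fun x => γ (g x) x) _ x := d1.clm_apply (hasFDerivAt_id x)
    have hv : fderiv ℝ (fun x => γ (g x) x) x v =
        γ (g x) v + (fderiv ℝ g x v) • (deriv γ (g x) x) := by
      have h1 : fderiv ℝ γ (g x) (fderiv ℝ g x v) = (fderiv ℝ g x v) • deriv γ (g x) := by
        rw [← fderiv_apply_one_eq_deriv, ← map_smul, smul_eq_mul, mul_one]
      rw [d2.fderiv]; simp [h1]
    have hb : ‖(fderiv ℝ g x v) • (deriv γ (g x) x)‖ ≤ C * δ * ‖v‖ := by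
      rw [norm_smul, Real.norm_eq_abs]
      calc _ ≤ |fderiv ℝ g x v| * (C * ‖x‖) := by
            gcongr
            exact (deriv γ (g x)).le_of_opNorm_le (hC _) x
        _ = C * (‖x‖ * |fderiv ℝ g x v|) := by ring
        _ ≤ C * (δ * ‖v‖) := mul_le_mul_of_nonneg_left (hgd x v) hC0
        _ = _ := by ring
    have h1 := hn (g x) v
    rw [hv]
    constructor
    · have := norm_sub_le_norm_add (γ (g x) v) ((fderiv ℝ g x v) • (deriv γ (g x) x))
      linarith
    · have := norm_add_le (γ (g x) v) ((fderiv ℝ g x v) • (deriv γ (g x) x))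
      linarith

theorem trans_part {δ : ℝ} {g : E → ℝ} {x₀ : E} (hg : ContDiff ℝ (⊤ : ℕ∞) g)
    (hgd : ∀ x v, ‖x₀‖ * |fderiv ℝ g x v| ≤ δ * ‖v‖) (hδ0 : 0 ≤ δ) (hδ : δ < 1) :
    Function.Bijective (fun x => x + g x • x₀) ∧ ContDiff ℝ (⊤ : ℕ∞) (fun x => x + g x • x₀) ∧
    ∀ x v, (1 - δ) * ‖v‖ ≤ ‖fderiv ℝ (fun x => x + g x • x₀) x v‖ ∧
      ‖fderiv ℝ (fun x => x + g x • x₀) x v‖ ≤ (1 + δ) * ‖v‖ := by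
  have hd : ∀ x, HasFDerivAt (fun x => g x • x₀) ((fderiv ℝ g x).smulRight x₀) x := fun x =>
    (hg.differentiable (by simp) x).hasFDerivAt.smul_const x₀
  have hb : ∀ x v, ‖(fderiv ℝ g x).smulRight x₀ v‖ ≤ δ * ‖v‖ := fun x v => by
    rw [ContinuousLinearMap.smulRight_apply, norm_smul, Real.norm_eq_abs, mul_comm]
    exact hgd x v
  have hlip : ∀ x y, ‖g x • x₀ - g y • x₀‖ ≤ δ * ‖x - y‖ := fun x y =>
    Convex.norm_image_sub_le_of_norm_hasFDerivWithin_le (s := Set.univ)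
      (f := fun x => g x • x₀) (fun z _ => (hd z).hasFDerivWithinAt)
      (fun z _ => ContinuousLinearMap.opNorm_le_bound _ hδ0 (hb z)) convex_univ trivial trivial
  have happ : ApproximatesLinearOn (fun x => x + g x • x₀)
      ((ContinuousLinearEquiv.refl ℝ E : E ≃L[ℝ] E) : E →L[ℝ] E) Set.univ ⟨δ, hδ0⟩ := by
    intro x _ y _
    simp only [ContinuousLinearEquiv.coe_refl, ContinuousLinearMap.coe_id', id]
    convert hlip x y using 2
    · abel
    · rfl
  have hc : Subsingleton E ∨ (⟨δ, hδ0⟩ : NNReal) <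
      ‖((ContinuousLinearEquiv.refl ℝ E).symm : E →L[ℝ] E)‖₊⁻¹ := by
    rcases subsingleton_or_nontrivial E with h | h
    · exact .inl h
    · right
      have : ‖((ContinuousLinearEquiv.refl ℝ E).symm : E →L[ℝ] E)‖₊ = 1 := by
        simp
      rw [this, inv_one]
      exact hδ
  refine ⟨⟨Set.injOn_univ.1 (happ.injOn hc), happ.surjective hc⟩, contDiff_id.add (hg.smul contDiff_const),
    fun x v => ?_⟩
  have d : HasFDerivAt (fun x => x + g x • x₀) _ x := (hasFDerivAt_id x).add (hd x)
  have hv : fderiv ℝ (fun x => x + g x • x₀) x v = v + (fderiv ℝ g x).smulRight x₀ v := by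
    rw [d.fderiv]; rfl
  rw [hv]
  have := hb x v
  constructor
  · have := norm_sub_le_norm_add v ((fderiv ℝ g x).smulRight x₀ v)
    linarith
  · have := norm_add_le v ((fderiv ℝ g x).smulRight x₀ v)
    linarith

end Gen

theorem arith_lo {δ : ℝ} (h0 : 0 < δ) (h1 : δ < 1 / 15) :
    1 ≤ ((1 - δ) ^ 2) ^ 2 * (1 + 15 * δ) := by
  have a : 1 - 2 * δ ≤ (1 - δ) ^ 2 := by nlinarith
  have b : (1 - 2 * δ) ^ 2 ≤ ((1 - δ) ^ 2) ^ 2 := pow_le_pow_left₀ (by linarith) a 2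
  have d : 1 - 4 * δ ≤ (1 - 2 * δ) ^ 2 := by nlinarith
  have e : (1 - 4 * δ) * (1 + 15 * δ) ≤ ((1 - δ) ^ 2) ^ 2 * (1 + 15 * δ) :=
    mul_le_mul_of_nonneg_right (d.trans b) (by linarith)
  nlinarith

theorem arith_hi {δ : ℝ} (h0 : 0 < δ) (h1 : δ < 1 / 15) :
    ((1 + δ) ^ 2) ^ 2 ≤ 1 + 15 * δ := by
  have a : (1 + δ) ^ 2 ≤ 1 + 3 * δ := by nlinarith
  have b : ((1 + δ) ^ 2) ^ 2 ≤ (1 + 3 * δ) ^ 2 := pow_le_pow_left₀ (by positivity) a 2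
  nlinarith

theorem slide_interpolation
    (D : ℕ) (hD : 2 ≤ D) :
    ∃ ε₀ > (0 : ℝ), ∀ ε : ℝ, 0 < ε → ε < ε₀ →
      ∃ η > (0 : ℝ), ∃ c > (0 : ℝ),
        ∀ T : Matrix (Fin D) (Fin D) ℝ,
          T ∈ Matrix.orthogonalGroup (Fin D) ℝ → T.det = 1 →
          ∀ (x₀ : EuclideanSpace ℝ (Fin D)) (r₁ r₂ : ℝ),
            0 < r₁ → r₁ ≤ η * r₂ → ‖x₀‖ ≤ c * ε * r₁ →
            ∃ Φ₂ : EuclideanSpace ℝ (Fin D) → EuclideanSpace ℝ (Fin D),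
              IsDistorted D ε Φ₂ ∧
              (∀ x, ‖x‖ ≤ r₁ → Φ₂ x = Matrix.toEuclideanLin T x + x₀) ∧
              (∀ x, r₂ ≤ ‖x‖ → Φ₂ x = x) := by
  obtain ⟨K, hK0, hK⟩ := exists_deriv_smoothTransition_bound
  refine ⟨1, one_pos, fun ε hε hε1 => ?_⟩
  have hpi := Real.pi_pos
  -- path constant, distortion of each factor, logarithmic width
  set C : ℝ := 4 * Real.pi * D + 1 with hC
  have hC0 : 1 ≤ C := by
    have : 0 ≤ 4 * Real.pi * (D : ℝ) := by positivity
    linarith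
  set δ : ℝ := ε / 15 with hδ
  have hδ0 : 0 < δ := by positivity
  set M : ℝ := 2 * K * C / δ with hM
  have hM0 : 0 < M := by positivity
  have hKM : C * (2 * K / M) = δ := by rw [hM]; field_simp
  have hKM0 : 0 ≤ 2 * K / M := by positivity
  have hKM1 : 2 * K / M ≤ δ := by nlinarith
  refine ⟨Real.exp (-M) / 2, by positivity, 1, one_pos, ?_⟩
  intro T hT hdet x₀ r₁ r₂ h1 h12 hx₀
  have h2 : 0 < r₂ := by
    by_contra h
    have : Real.exp (-M) / 2 * r₂ ≤ 0 :=
      mul_nonpos_of_nonneg_of_nonpos (by positivity) (not_lt.1 h)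
    linarith
  have hr : M ≤ Real.log (r₂ ^ 2) - Real.log (2 * r₁ ^ 2) := by
    rw [← Real.log_div (by positivity) (by positivity), Real.le_log_iff_exp_le (by positivity),
      le_div_iff₀ (by positivity)]
    have he : Real.exp M * Real.exp (-M) = 1 := by rw [← Real.exp_add]; simp
    have he1 : Real.exp (-M) ≤ 1 := Real.exp_le_one_iff.2 (by linarith)
    have hsq : r₁ ^ 2 ≤ (Real.exp (-M) / 2 * r₂) ^ 2 := by gcongr
    calc Real.exp M * (2 * r₁ ^ 2) ≤ Real.exp M * (2 * (Real.exp (-M) / 2 * r₂) ^ 2) := by gcongr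
      _ = (Real.exp M * Real.exp (-M)) * (Real.exp (-M) * r₂ ^ 2 / 2) := by ring
      _ = Real.exp (-M) * r₂ ^ 2 / 2 := by rw [he, one_mul]
      _ ≤ 1 * r₂ ^ 2 := by nlinarith [sq_nonneg r₂]
      _ = r₂ ^ 2 := one_mul _
  obtain ⟨g, gc, g1, g0, gn, gd, gd'⟩ :=
    exists_cutoff (E := EuclideanSpace ℝ (Fin D)) hK h1 h2 hM0 hr
  -- the isometry
  have hTn : ∀ x, ‖Matrix.toEuclideanLin T x‖ = ‖x‖ := by
    intro x
    have h : T.transpose * T = 1 := Matrix.mem_orthogonalGroup_iff' _ _ |>.1 hT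
    have : inner ℝ (Matrix.toEuclideanLin T x) (Matrix.toEuclideanLin T x) = (inner ℝ x x : ℝ) := by
      rw [← LinearMap.adjoint_inner_left, ← Matrix.toEuclideanLin_conjTranspose_eq_adjoint]
      congr 1
      apply (WithLp.ofLp_injective 2)
      simp [Matrix.ofLp_toEuclideanLin_apply, Matrix.conjTranspose_eq_transpose_of_trivial, h]
    rw [real_inner_self_eq_norm_sq, real_inner_self_eq_norm_sq] at this
    exact (pow_left_inj₀ (norm_nonneg _) (norm_nonneg _) two_ne_zero).1 this
  let li : EuclideanSpace ℝ (Fin D) →ₗᵢ[ℝ] EuclideanSpace ℝ (Fin D) :=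
    ⟨Matrix.toEuclideanLin T, hTn⟩
  let φ := li.toLinearIsometryEquiv rfl
  have hφ : φ.toLinearEquiv.toLinearMap = Matrix.toEuclideanLin T := rfl
  have hφd : LinearMap.det φ.toLinearEquiv.toLinearMap = 1 := by
    rw [hφ, Matrix.toEuclideanLin_eq_toLin, LinearMap.det_toLin, hdet]
  obtain ⟨-, γ, γc, γ0, γ1, γn, γd⟩ := goodPath_of_det φ hφd
  have γd' : ∀ t, ‖deriv γ t‖ ≤ C := fun t => (γd t).trans (by
    rw [finrank_euclideanSpace_fin]; linarith)
  obtain ⟨Rb, Rc, Rd⟩ := rot_part γc γn γd' (by linarith) gc gn gd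
  rw [hKM] at Rd
  have hx₀r : ‖x₀‖ ≤ r₁ := by nlinarith
  obtain ⟨Tb, Tc, Td⟩ := trans_part (x₀ := x₀) (δ := δ) gc (fun x v => by
    calc _ ≤ r₁ * |fderiv ℝ g x v| := by gcongr
      _ ≤ 2 * K / M * ‖v‖ := gd' x v
      _ ≤ δ * ‖v‖ := by gcongr) hδ0.le (by linarith)
  set R := fun x => γ (g x) x with hR
  set S := fun x => x + g x • x₀ with hS
  have hch : ∀ x v, fderiv ℝ (S ∘ R) x v = fderiv ℝ S (R x) (fderiv ℝ R x v) := fun x v => by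
    rw [fderiv_comp x (Tc.differentiable (by simp) _) (Rc.differentiable (by simp) _)]
    rfl
  have hd : ∀ x v, (1 - δ) ^ 2 * ‖v‖ ≤ ‖fderiv ℝ (S ∘ R) x v‖ ∧
      ‖fderiv ℝ (S ∘ R) x v‖ ≤ (1 + δ) ^ 2 * ‖v‖ := fun x v => by
    rw [hch]
    obtain ⟨a1, a2⟩ := Rd x v
    obtain ⟨b1, b2⟩ := Td (R x) (fderiv ℝ R x v)
    have : 0 < 1 - δ := by linarith
    constructor <;> nlinarith
  have hδ1 : δ < 1 / 15 := by linarith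
  have hεδ : ε = 15 * δ := by rw [hδ]; ring
  refine ⟨S ∘ R, ⟨Tb.comp Rb, Tc.comp Rc, ?_, fun x v => ?_⟩, fun x hx => ?_, fun x hx => ?_⟩
  · refine contDiff_invFun_of (Tb.comp Rb) (Tc.comp Rc) fun x v h => ?_
    have := (hd x v).1
    rw [h, norm_zero] at this
    have h3 : 0 < (1 - δ) ^ 2 := by apply pow_pos; linarith
    exact norm_le_zero_iff.1 (by by_contra hv; nlinarith [mul_pos h3 (not_le.1 hv)])
  · obtain ⟨a1, a2⟩ := hd x v
    have c1 : 0 ≤ (1 - δ) ^ 2 * ‖v‖ := by positivity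
    have s1 := pow_le_pow_left₀ c1 a1 2
    have s2 := pow_le_pow_left₀ (norm_nonneg _) a2 2
    constructor
    · refine le_trans ?_ s1
      rw [mul_pow]
      gcongr
      rw [inv_le_iff_one_le_mul₀ (by linarith), hεδ]
      exact arith_lo hδ0 hδ1
    · refine le_trans s2 ?_
      rw [mul_pow]
      gcongr
      rw [hεδ]
      exact arith_hi hδ0 hδ1
  · have hRx : R x = Matrix.toEuclideanLin T x := by
      simp only [hR, g1 x hx, γ1]; rfl
    have : ‖R x‖ ≤ r₁ := by rw [hRx, hTn]; exact hx
    change R x + g (R x) • x₀ = _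
    rw [g1 _ this, one_smul, hRx]
  · have hRx : R x = x := by simp [hR, g0 x hx, γ0]
    simp only [Function.comp, hS, hRx, g0 x hx, zero_smul, add_zero]
end

section
/- Let D ≥ 2 and let ε > 0 be small enough (less than a constant depending only on D). Then there exist η > 0 and c > 0 depending on ε and D such that the following holds: let 0 < r_1 ≤ η r_2 and let x, x' ∈ ℝ^D with |x − x'| ≤ c ε r_1 and |x| ≤ r_1. Then there exists an ε-distorted diffeomorphism Φ : ℝ^D → ℝ^D such that Φ(x) = x' and Φ(y) = y for all y with |y| ≥ r_2. -/
theorem lipschitz_perturb_distorted (D : ℕ) (ε : ℝ) (hε : 0 < ε) (hε1 : ε < 1)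
    (g : EuclideanSpace ℝ (Fin D) → EuclideanSpace ℝ (Fin D))
    (hg : ContDiff ℝ (⊤ : ℕ∞) g) (δ : NNReal) (hδ : (δ : ℝ) = ε / 8)
    (hL : LipschitzWith δ g) :
    IsDistorted D ε (fun y => y + g y) := by
  have hΦ : ContDiff ℝ (⊤ : ℕ∞) (fun y => y + g y) := contDiff_id.add hg
  have happ : ApproximatesLinearOn (fun y => y + g y)
      ((ContinuousLinearEquiv.refl ℝ (EuclideanSpace ℝ (Fin D)) :
        EuclideanSpace ℝ (Fin D) ≃L[ℝ] EuclideanSpace ℝ (Fin D)) :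
        EuclideanSpace ℝ (Fin D) →L[ℝ] EuclideanSpace ℝ (Fin D)) Set.univ δ := by
    intro y _ z _
    have := hL.norm_sub_le y z
    have h2 : y + g y - (z + g z) - (y - z) = g y - g z := by abel
    rw [← h2] at this
    exact this
  have hfd : ∀ y, fderiv ℝ (fun y => y + g y) y
      = ContinuousLinearMap.id ℝ (EuclideanSpace ℝ (Fin D)) + fderiv ℝ g y := by
    intro y
    have h1 : DifferentiableAt ℝ g y := hg.differentiable (by simp) y
    exact ((hasFDerivAt_id y).add h1.hasFDerivAt).fderiv
  have hup : ∀ y v, ‖fderiv ℝ g y v‖ ≤ ε / 8 * ‖v‖ := by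
    intro y v
    have h1 : ‖fderiv ℝ g y‖ ≤ δ := norm_fderiv_le_of_lipschitz ℝ hL
    rw [hδ] at h1
    exact (ContinuousLinearMap.le_opNorm _ _).trans (by gcongr)
  have hlow : ∀ y v, (1 - ε / 8) * ‖v‖ ≤ ‖fderiv ℝ (fun y => y + g y) y v‖ := by
    intro y v
    rw [hfd]
    have h2 := norm_sub_le (v + fderiv ℝ g y v) (fderiv ℝ g y v)
    rw [add_sub_cancel_right] at h2
    have := hup y v
    simp only [add_apply, ContinuousLinearMap.id_apply]
    linarith
  have hupp : ∀ y v, ‖fderiv ℝ (fun y => y + g y) y v‖ ≤ (1 + ε / 8) * ‖v‖ := by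
    intro y v
    rw [hfd]
    have h2 := norm_add_le v (fderiv ℝ g y v)
    have := hup y v
    simp only [add_apply, ContinuousLinearMap.id_apply]
    linarith
  have hc : Subsingleton (EuclideanSpace ℝ (Fin D)) ∨
      δ < ‖((ContinuousLinearEquiv.refl ℝ (EuclideanSpace ℝ (Fin D))).symm :
        EuclideanSpace ℝ (Fin D) →L[ℝ] EuclideanSpace ℝ (Fin D))‖₊⁻¹ := by
    rcases subsingleton_or_nontrivial (EuclideanSpace ℝ (Fin D)) with h | h
    · exact Or.inl h
    · right
      have : ‖((ContinuousLinearEquiv.refl ℝ (EuclideanSpace ℝ (Fin D))).symm :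
        EuclideanSpace ℝ (Fin D) →L[ℝ] EuclideanSpace ℝ (Fin D))‖₊ = 1 := by
        apply NNReal.eq
        exact ContinuousLinearMap.norm_id
      rw [this, inv_one, ← NNReal.coe_lt_coe, hδ]
      simp; linarith
  let e := happ.toHomeomorph _ hc
  have he : ∀ y, e y = y + g y := fun y => rfl
  have hbij : Function.Bijective (fun y => y + g y) := e.bijective
  have hinv : Function.invFun (fun y => y + g y) = e.symm := by
    funext z
    apply hbij.1
    rw [Function.rightInverse_invFun hbij.2 z]
    exact (e.apply_symm_apply z).symm
  refine ⟨hbij, hΦ, ?_, ?_⟩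
  · rw [hinv]
    have hinj : ∀ y, Function.Injective (fderiv ℝ (fun y => y + g y) y) := by
      intro y
      rw [injective_iff_map_eq_zero]
      intro v hv
      have := hlow y v
      rw [hv, norm_zero] at this
      have hv0 : ‖v‖ ≤ 0 := by nlinarith [norm_nonneg v]
      simpa using hv0
    let f' : ∀ y, EuclideanSpace ℝ (Fin D) ≃L[ℝ] EuclideanSpace ℝ (Fin D) := fun y =>
      (LinearEquiv.ofInjectiveEndo (fderiv ℝ (fun y => y + g y) y).toLinearMap
        (hinj y)).toContinuousLinearEquiv
    refine e.contDiff_symm (f₀' := f') ?_ hΦ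
    intro y
    have h1 := (hΦ.differentiable (by simp) y).hasFDerivAt
    have h2 : (f' y : EuclideanSpace ℝ (Fin D) →L[ℝ] EuclideanSpace ℝ (Fin D))
        = fderiv ℝ (fun y => y + g y) y := by
      apply ContinuousLinearMap.ext
      intro v
      rfl
    rw [h2]
    exact h1
  · intro y v
    have h1 := hlow y v
    have h2 := hupp y v
    have hv := norm_nonneg v
    constructor
    · have h3 : ((1 - ε / 8) * ‖v‖) ^ 2 ≤ ‖fderiv ℝ (fun y => y + g y) y v‖ ^ 2 := by
        apply pow_le_pow_left₀ _ h1
        apply mul_nonneg _ hv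
        linarith
      refine le_trans ?_ h3
      rw [mul_pow]
      gcongr
      rw [inv_le_iff_one_le_mul₀ (by linarith)]
      nlinarith [mul_pos hε hε, mul_pos (mul_pos hε hε) hε]
    · have h3 : ‖fderiv ℝ (fun y => y + g y) y v‖ ^ 2 ≤ ((1 + ε / 8) * ‖v‖) ^ 2 :=
        pow_le_pow_left₀ (norm_nonneg _) h2 2
      refine le_trans h3 ?_
      rw [mul_pow]
      gcongr
      nlinarith

/-- For small `ε` there are `η, c > 0` such that whenever `0 < r₁ ≤ η r₂`
and `x, x' ∈ ℝ^D` satisfy `|x − x'| ≤ c ε r₁` and `|x| ≤ r₁`, there is an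
`ε`-distorted diffeomorphism `Φ` with `Φ(x) = x'` and `Φ(y) = y` for `|y| ≥ r₂`. -/
theorem move_one_point
    (D : ℕ) (hD : 2 ≤ D) :
    ∃ ε₀ > (0 : ℝ), ∀ ε : ℝ, 0 < ε → ε < ε₀ →
      ∃ η > (0 : ℝ), ∃ c > (0 : ℝ),
        ∀ r₁ r₂ : ℝ, 0 < r₁ → r₁ ≤ η * r₂ →
          ∀ x x' : EuclideanSpace ℝ (Fin D),
            dist x x' ≤ c * ε * r₁ → ‖x‖ ≤ r₁ →
            ∃ Φ : EuclideanSpace ℝ (Fin D) → EuclideanSpace ℝ (Fin D),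
              IsDistorted D ε Φ ∧
              Φ x = x' ∧
              (∀ y, r₂ ≤ ‖y‖ → Φ y = y) := by
  let χ : ContDiffBump (0 : EuclideanSpace ℝ (Fin D)) := ⟨1, 2, by norm_num, by norm_num⟩
  have hχ : ContDiff ℝ (⊤ : ℕ∞) χ := χ.contDiff
  obtain ⟨K, hK⟩ : ∃ K : NNReal, LipschitzWith K χ :=
    hχ.lipschitzWith_of_hasCompactSupport χ.hasCompactSupport (by simp)
  refine ⟨1, one_pos, fun ε hε hε1 => ⟨1 / 2, by norm_num, 1 / (8 * ((K : ℝ) + 1)),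
    by positivity, ?_⟩⟩
  intro r₁ r₂ hr₁ hr x x' hxx hx
  refine ⟨fun y => y + χ (r₁⁻¹ • y) • (x' - x), ?_, ?_, ?_⟩
  · refine lipschitz_perturb_distorted D ε hε hε1 (fun y => χ (r₁⁻¹ • y) • (x' - x)) ?_
      ⟨ε / 8, by positivity⟩ rfl ?_
    · exact (hχ.comp (contDiff_const_smul _)).smul contDiff_const
    · refine LipschitzWith.of_dist_le_mul fun y z => ?_
      rw [dist_eq_norm, dist_eq_norm, ← sub_smul, norm_smul]
      have h1 := hK.norm_sub_le (r₁⁻¹ • y) (r₁⁻¹ • z)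
      rw [← smul_sub, norm_smul, norm_inv, Real.norm_of_nonneg hr₁.le] at h1
      rw [dist_comm, dist_eq_norm] at hxx
      have hK0 : (0 : ℝ) ≤ K := K.2
      calc ‖χ (r₁⁻¹ • y) - χ (r₁⁻¹ • z)‖ * ‖x' - x‖
          ≤ (K * (r₁⁻¹ * ‖y - z‖)) * (1 / (8 * ((K : ℝ) + 1)) * ε * r₁) := by gcongr
        _ = (K / (K + 1)) * (ε / 8 * ‖y - z‖) := by field_simp
        _ ≤ 1 * (ε / 8 * ‖y - z‖) := by
            gcongr
            rw [div_le_one (by positivity)]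
            linarith
        _ = _ := by rw [one_mul]; rfl
  · have : χ (r₁⁻¹ • x) = 1 := by
      apply χ.one_of_mem_closedBall
      rw [mem_closedBall_zero_iff, norm_smul, norm_inv, Real.norm_of_nonneg hr₁.le]
      show r₁⁻¹ * ‖x‖ ≤ 1
      rw [inv_mul_le_iff₀ hr₁]
      linarith
    simp [this]
  · intro y hy
    have : χ (r₁⁻¹ • y) = 0 := by
      apply χ.zero_of_le_dist
      rw [dist_zero_right, norm_smul, norm_inv, Real.norm_of_nonneg hr₁.le]
      show 2 ≤ r₁⁻¹ * ‖y‖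
      rw [le_inv_mul_iff₀ hr₁]
      linarith
    simp [this]
end

section
/- Let D ≥ 2. There exists ε_0 > 0 depending only on D such that for every sufficiently small δ > 0 there exist 2D+1 distinct points y_1,...,y_{2D+1} ∈ ℝ^D and a map φ : {y_1,...,y_{2D+1}} → {y_1,...,y_{2D+1}} which distorts distances by at most a factor 1 + Cδ (i.e., (1+Cδ)^{-1}|y_i − y_j| ≤ |φ(y_i) − φ(y_j)| ≤ (1+Cδ)|y_i − y_j| for all i ≠ j, with C depending only on D), yet there is no bijection Φ : ℝ^D → ℝ^D extending φ and satisfying (1+ε_0)^{-1}|x − x'| ≤ |Φ(x) − Φ(x')| ≤ (1+ε_0)|x − x'| for all x, x' ∈ ℝ^D. Explicitly, one may take y_1,...,y_{D+1} to be the vertices of a regular simplex inscribed in the sphere of radius δ about the origin, y_{D+1},...,y_{2D+1} to be the vertices of a regular simplex inscribed in a sphere of radius 1 centered at some point w_1 ∈ ℝ^D, φ restricted to {y_1,...,y_{D+1}} an odd permutation fixing y_{D+1}, and φ restricted to {y_{D+1},...,y_{2D+1}} the identity. -/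
open Finset in
theorem aux_simplex (D : ℕ) (hD : 2 ≤ D) :
    ∃ (v : ℕ → EuclideanSpace ℝ (Fin D)) (s : ℝ), 0 < s ∧ (∀ i, i ≤ D → ‖v i‖ = 1) ∧
      ∀ i j, i ≤ D → j ≤ D → i ≠ j → dist (v i) (v j) = s := by
  have hDr : (2 : ℝ) ≤ D := by exact_mod_cast hD
  obtain ⟨q, hq0, hq⟩ : ∃ q : ℝ, 1 < q ∧ (D : ℝ) = q ^ 2 - 1 := by
    refine ⟨√(1 + D), ?_, ?_⟩
    · rw [Real.lt_sqrt (by norm_num)]; linarith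
    · rw [Real.sq_sqrt (by linarith)]; ring
  have hq1 : q - 1 ≠ 0 := by linarith
  have hq2 : q + 1 ≠ 0 := by linarith
  have hq3 : q ≠ 0 := by linarith
  -- here lam = -1/(q+1), m = 1/(q*(q+1))
  obtain ⟨lam, hlam⟩ : ∃ l : ℝ, l = -1 / (q + 1) := ⟨_, rfl⟩
  obtain ⟨m, hm⟩ : ∃ m : ℝ, m = 1 / (q * (q + 1)) := ⟨_, rfl⟩
  have e1 : (1 - lam) ^ 2 + (D - 1) * lam ^ 2 = 2 := by
    rw [hq, hlam]; field_simp; ring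
  have e2 : (1 - m) ^ 2 + (D - 1) * m ^ 2 = D * (lam - m) ^ 2 := by
    rw [hq, hlam, hm]; field_simp; ring
  have hm0 : 0 < m := by rw [hm]; positivity
  have hRpos : 0 < (1 - m) ^ 2 + (D - 1) * m ^ 2 := by
    have : 0 < ((D : ℝ) - 1) * m ^ 2 := mul_pos (by linarith) (by positivity)
    nlinarith [sq_nonneg (1 - m)]
  obtain ⟨R, hR0, hR⟩ : ∃ R : ℝ, 0 < R ∧ R ^ 2 = (1 - m) ^ 2 + (D - 1) * m ^ 2 :=
    ⟨√((1 - m) ^ 2 + (D - 1) * m ^ 2), Real.sqrt_pos.2 hRpos, Real.sq_sqrt hRpos.le⟩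
  let P : ℕ → EuclideanSpace ℝ (Fin D) := fun i =>
    WithLp.toLp 2 (fun k : Fin D => if i < D then (if k.val = i then 1 else 0) else lam)
  let M : EuclideanSpace ℝ (Fin D) := WithLp.toLp 2 (fun _ => m)
  have sum1 : ∀ (i : ℕ) (a b : ℝ), i < D →
      ∑ k : Fin D, (if k.val = i then a else b) = a + (D - 1) * b := by
    intro i a b hi
    have : ∀ k : Fin D, (if k.val = i then a else b) = (if k = ⟨i, hi⟩ then a - b else 0) + b := by
      intro k
      by_cases h : k.val = i
      · have : k = ⟨i, hi⟩ := Fin.ext h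
        simp [this]
      · have : k ≠ ⟨i, hi⟩ := fun h' => h (by rw [h'])
        simp [h, this]
    rw [sum_congr rfl (fun k _ => this k), sum_add_distrib]
    simp
    ring
  have nP : ∀ i, i ≤ D → ‖P i - M‖ = R := by
    intro i hi
    rw [← sq_eq_sq₀ (norm_nonneg _) hR0.le, EuclideanSpace.norm_sq_eq, hR]
    by_cases h : i < D
    · rw [← sum1 i _ _ h]
      refine sum_congr rfl fun k _ => ?_
      simp only [P, M, PiLp.sub_apply, h, if_true, Real.norm_eq_abs, sq_abs]
      split_ifs <;> ring
    · simp only [P, M, PiLp.sub_apply, h, if_false, Real.norm_eq_abs, sq_abs]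
      rw [e2]; simp
  have dlast : ∀ i, i < D → ‖P i - P D‖ = √2 := by
    intro i h
    rw [← sq_eq_sq₀ (norm_nonneg _) (Real.sqrt_nonneg _), EuclideanSpace.norm_sq_eq,
      Real.sq_sqrt (by norm_num), ← e1, ← sum1 i _ _ h]
    refine sum_congr rfl fun k _ => ?_
    simp only [P, PiLp.sub_apply, h, if_true, Real.norm_eq_abs, sq_abs, lt_irrefl, if_false]
    split_ifs <;> ring
  have dne : ∀ i j, i < D → j < D → i ≠ j → ‖P i - P j‖ = √2 := by
    intro i j hi hj hij
    rw [← sq_eq_sq₀ (norm_nonneg _) (Real.sqrt_nonneg _), EuclideanSpace.norm_sq_eq,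
      Real.sq_sqrt (by norm_num)]
    have : (2 : ℝ) = ∑ k : Fin D, ((if k.val = i then (1 : ℝ) else 0)
        + (if k.val = j then (1 : ℝ) else 0)) := by
      rw [sum_add_distrib, sum1 i _ _ hi, sum1 j _ _ hj]; norm_num
    rw [this]
    refine sum_congr rfl fun k _ => ?_
    simp only [P, PiLp.sub_apply, hi, hj, if_true, Real.norm_eq_abs, sq_abs]
    split_ifs with h1 h2 <;> first | (exfalso; omega) | norm_num
  have dP : ∀ i j, i ≤ D → j ≤ D → i ≠ j → ‖P i - P j‖ = √2 := by
    intro i j hi hj hij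
    rcases hi.lt_or_eq with h1 | rfl
    · rcases hj.lt_or_eq with h2 | rfl
      · exact dne i j h1 h2 hij
      · exact dlast i h1
    · rw [norm_sub_rev]; exact dlast j (by omega)
  refine ⟨fun i => R⁻¹ • (P i - M), R⁻¹ * √2, by positivity, ?_, ?_⟩
  · intro i hi
    rw [norm_smul, nP i hi, Real.norm_eq_abs, abs_of_pos (by positivity)]
    field_simp
  · intro i j hi hj hij
    rw [dist_eq_norm, ← smul_sub, sub_sub_sub_cancel_right, norm_smul, dP i j hi hj hij,
      Real.norm_eq_abs, abs_of_pos (by positivity)]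

/-- Vectors whose norms and mutual distances are all nearly `s` are linearly independent. -/
theorem aux_nonsing (D : ℕ) (s η : ℝ) (hs : 0 < s) (hη0 : 0 ≤ η) (hη : 3 * η * D < 1)
    (a : Fin D → EuclideanSpace ℝ (Fin D))
    (h1 : ∀ i, |‖a i‖ ^ 2 - s ^ 2| ≤ η * s ^ 2)
    (h2 : ∀ i j, i ≠ j → |‖a i - a j‖ ^ 2 - s ^ 2| ≤ η * s ^ 2) :
    (Matrix.of fun i k => a i k).det ≠ 0 := by
  intro hdet
  obtain ⟨c, hc0, hc⟩ := Matrix.exists_vecMul_eq_zero_iff.2 hdet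
  have hsum : ∑ i, c i • a i = 0 := by
    ext k
    have := congrFun hc k
    simpa [Matrix.vecMul, dotProduct, Finset.sum_apply] using this
  have hin : ∑ i, ∑ j, c i * c j * inner ℝ (a i) (a j) = 0 := by
    have : inner ℝ (∑ i, c i • a i) (∑ j, c j • a j) = (0 : ℝ) := by rw [hsum]; simp
    rw [sum_inner] at this
    simp_rw [inner_sum, real_inner_smul_left, real_inner_smul_right] at this
    rw [← this]
    refine Finset.sum_congr rfl fun i _ => Finset.sum_congr rfl fun j _ => by ring
  have key : ∀ i j, |inner ℝ (a i) (a j) - s ^ 2 / 2 * (1 + if i = j then 1 else 0)|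
      ≤ 3 / 2 * η * s ^ 2 := by
    intro i j
    by_cases hij : i = j
    · subst hij
      rw [real_inner_self_eq_norm_sq]
      have := abs_le.1 (h1 i)
      have h0 : 0 ≤ η * s ^ 2 := by positivity
      simp only [if_true]
      rw [abs_le]; constructor <;> linarith
    · have t1 := abs_le.1 (h1 i)
      have t2 := abs_le.1 (h1 j)
      have t3 := abs_le.1 (h2 i j hij)
      have := norm_sub_sq_real (a i) (a j)
      simp only [hij, if_false]
      rw [abs_le]; constructor <;> linarith
  have e1 : ∑ i, ∑ j, c i * c j * (s ^ 2 / 2 * (1 + if i = j then (1:ℝ) else 0))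
      = s ^ 2 / 2 * ((∑ i, c i) ^ 2 + ∑ i, c i ^ 2) := by
    rw [sq (∑ i, c i), Finset.sum_mul_sum, ← Finset.sum_add_distrib, Finset.mul_sum]
    refine Finset.sum_congr rfl fun i _ => ?_
    have : c i ^ 2 = ∑ j, c i * c j * (if i = j then (1:ℝ) else 0) := by simp [sq]
    rw [this, ← Finset.sum_add_distrib, Finset.mul_sum]
    refine Finset.sum_congr rfl fun j _ => by ring
  have e2 : ∑ i, ∑ j, c i * c j * (s ^ 2 / 2 * (1 + if i = j then (1:ℝ) else 0))
      ≤ ∑ i, ∑ j, |c i| * |c j| * (3 / 2 * η * s ^ 2) := by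
    refine (sub_zero _).symm.le.trans ((sub_le_sub_left hin.le _).trans ?_)
    rw [← Finset.sum_sub_distrib]
    refine Finset.sum_le_sum fun i _ => ?_
    rw [← Finset.sum_sub_distrib]
    refine Finset.sum_le_sum fun j _ => ?_
    rw [← mul_sub]
    refine (le_abs_self _).trans ?_
    rw [abs_mul, abs_mul, abs_sub_comm]
    exact mul_le_mul_of_nonneg_left (key i j) (by positivity)
  have e3 : ∑ i, ∑ j, |c i| * |c j| * (3 / 2 * η * s ^ 2) = (3 / 2 * η * s ^ 2) * (∑ i, |c i|) ^ 2 := by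
    rw [sq (∑ i, |c i|), Finset.sum_mul_sum, Finset.mul_sum]
    refine Finset.sum_congr rfl fun i _ => ?_
    rw [Finset.mul_sum]
    refine Finset.sum_congr rfl fun j _ => by ring
  have e4 : (∑ i, |c i|) ^ 2 ≤ D * ∑ i, c i ^ 2 := by
    have := sq_sum_le_card_mul_sum_sq (s := Finset.univ) (f := fun i => |c i|)
    simpa using this
  have hpos : 0 < ∑ i, c i ^ 2 := by
    obtain ⟨i, hi⟩ := Function.ne_iff.1 hc0
    exact Finset.sum_pos' (fun i _ => sq_nonneg _) ⟨i, Finset.mem_univ _, by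
      have : c i ≠ 0 := hi
      positivity⟩
  rw [e1, e3] at e2
  have e5 : (3 / 2 * η * s ^ 2) * (∑ i, |c i|) ^ 2 ≤ (3 / 2 * η * s ^ 2) * (D * ∑ i, c i ^ 2) :=
    mul_le_mul_of_nonneg_left e4 (by positivity)
  have hs2 : 0 < s ^ 2 / 2 * ∑ i, c i ^ 2 := by positivity
  have e6 : 0 ≤ s ^ 2 / 2 * (∑ i, c i) ^ 2 := by positivity
  nlinarith [mul_pos hs2 (sub_pos.2 hη)]

theorem aux_sq (e d x r s : ℝ) (he : 0 < e) (he1 : e ≤ 1) (hr : 0 < r) (hs : 0 < s)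
    (hd : d = r * s) (h1 : (1 + e)⁻¹ * d ≤ x) (h2 : x ≤ (1 + e) * d) :
    |(r⁻¹ * x) ^ 2 - s ^ 2| ≤ 3 * e * s ^ 2 := by
  subst hd
  have hx : 0 ≤ x := le_trans (by positivity) h1
  obtain ⟨z, hz⟩ : ∃ z, z = r⁻¹ * x := ⟨_, rfl⟩
  have hxz : x = r * z := by rw [hz]; field_simp
  rw [← hz]
  have hz0 : 0 ≤ z := by rw [hz]; positivity
  rw [hxz] at h1 h2
  rw [inv_mul_le_iff₀ (by positivity)] at h1
  have h1' : s ≤ (1 + e) * z := by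
    refine le_of_mul_le_mul_left ?_ hr; linarith
  have h2' : z ≤ (1 + e) * s := by
    refine le_of_mul_le_mul_left ?_ hr; linarith
  have a1 : s ^ 2 ≤ ((1 + e) * z) ^ 2 := pow_le_pow_left₀ hs.le h1' 2
  have a2 : z ^ 2 ≤ ((1 + e) * s) ^ 2 := pow_le_pow_left₀ hz0 h2' 2
  have b1 : (1 + e) ^ 2 ≤ 1 + 3 * e := by nlinarith
  have a3 : z ^ 2 ≤ (1 + 3 * e) * s ^ 2 := by
    rw [mul_pow] at a2; exact a2.trans (mul_le_mul_of_nonneg_right b1 (by positivity))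
  have a4 : s ^ 2 ≤ (1 + 3 * e) * z ^ 2 := by
    rw [mul_pow] at a1; exact a1.trans (mul_le_mul_of_nonneg_right b1 (by positivity))
  rw [abs_le]
  constructor
  · by_cases h : z ^ 2 ≤ s ^ 2
    · nlinarith [mul_le_mul_of_nonneg_left h he.le]
    · nlinarith [mul_nonneg he.le (sq_nonneg s)]
  · linarith

theorem aux_noext (D : ℕ) (hD : 2 ≤ D) (v : ℕ → EuclideanSpace ℝ (Fin D)) (s : ℝ) (hs : 0 < s)
    (hv : ∀ i j, i ≤ D → j ≤ D → i ≠ j → dist (v i) (v j) = s)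
    (p : EuclideanSpace ℝ (Fin D)) (δ e : ℝ) (hδ : 0 < δ) (hδ1 : δ ≤ 1) (he : 0 < e)
    (he1 : e ≤ 1) (heD : 9 * e * D < 1)
    (Φ : EuclideanSpace ℝ (Fin D) → EuclideanSpace ℝ (Fin D))
    (hΦ : ∀ x x', (1 + e)⁻¹ * dist x x' ≤ dist (Φ x) (Φ x') ∧
              dist (Φ x) (Φ x') ≤ (1 + e) * dist x x')
    (hp : Φ p = p)
    (hbig : ∀ i, i < D → Φ (p + (v i - v D)) = p + (v i - v D))
    (hsmall : ∀ i, i < D → Φ (p + δ • (v i - v D)) = p + δ • (v (Equiv.swap 0 1 i) - v D)) :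
    False := by
  have hcont : Continuous Φ := by
    have : LipschitzWith ⟨1 + e, by positivity⟩ Φ :=
      LipschitzWith.of_dist_le_mul fun x x' => (hΦ x x').2
    exact this.continuous
  let F : ℝ → Matrix (Fin D) (Fin D) ℝ := fun r =>
    Matrix.of fun i k => (Φ (p + r • (v i - v D)) - Φ p) k
  have hF : Continuous fun r => (F r).det := by
    refine Continuous.matrix_det ?_
    refine continuous_matrix fun i k => ?_
    simp only [F, Matrix.of_apply]
    fun_prop
  have hne : ∀ r, 0 < r → (F r).det ≠ 0 := by
    intro r hr hdet
    refine aux_nonsing D s (3 * e) hs (by positivity) (by linarith)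
      (fun i => r⁻¹ • (Φ (p + r • (v i - v D)) - Φ p)) ?_ ?_ ?_
    · intro i
      rw [norm_smul, Real.norm_eq_abs, abs_of_pos (inv_pos.2 hr), ← dist_eq_norm]
      refine aux_sq e _ _ r s he he1 hr hs ?_ (hΦ _ _).1 (hΦ _ _).2
      rw [dist_eq_norm, add_sub_cancel_left, norm_smul, ← dist_eq_norm,
        hv _ _ i.2.le le_rfl i.2.ne, Real.norm_eq_abs, abs_of_pos hr]
    · intro i j hij
      rw [← smul_sub, sub_sub_sub_cancel_right,
        norm_smul, Real.norm_eq_abs, abs_of_pos (inv_pos.2 hr), ← dist_eq_norm]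
      refine aux_sq e _ _ r s he he1 hr hs ?_ (hΦ _ _).1 (hΦ _ _).2
      rw [dist_eq_norm, add_sub_add_left_eq_sub, ← smul_sub, sub_sub_sub_cancel_right,
        norm_smul, ← dist_eq_norm,
        hv _ _ i.2.le j.2.le (fun h => hij (Fin.ext h)), Real.norm_eq_abs, abs_of_pos hr]
    · have : (Matrix.of fun (i : Fin D) k => (r⁻¹ • (Φ (p + r • (v i - v D)) - Φ p)) k) = r⁻¹ • F r := by
        ext i k; simp [F]
      rw [this, Matrix.det_smul, hdet, mul_zero]
  let τ : Equiv.Perm (Fin D) := Equiv.swap ⟨0, by omega⟩ ⟨1, by omega⟩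
  have hτ : ∀ i : Fin D, ((τ i : Fin D) : ℕ) = Equiv.swap 0 1 (i : ℕ) := by
    intro i
    simp only [τ, Equiv.swap_apply_def, Fin.ext_iff]
    split_ifs <;> rfl
  have hτs : Equiv.Perm.sign τ = -1 := Equiv.Perm.sign_swap (by simp [Fin.ext_iff])
  have hd : (F δ).det = - (δ ^ D * (F 1).det) := by
    have : F δ = δ • (F 1).submatrix τ id := by
      ext i k
      have hb := hbig _ (τ i).2
      rw [hτ] at hb
      simp only [F, Matrix.of_apply, Matrix.smul_apply, Matrix.submatrix_apply, id, one_smul,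
        hp, hsmall _ i.2, hτ, hb, add_sub_cancel_left, PiLp.smul_apply]
    rw [this, Matrix.det_smul, Matrix.det_permute, hτs]
    simp
  have h1 := hne 1 one_pos
  have hpow : 0 < δ ^ D := by positivity
  rcases lt_or_gt_of_ne h1 with h | h
  · have : (0 : ℝ) ∈ Set.Icc (F 1).det (F δ).det := ⟨h.le, by rw [hd]; nlinarith⟩
    obtain ⟨r, hr, hr0⟩ := intermediate_value_Icc' hδ1 hF.continuousOn this
    exact hne r (hδ.trans_le hr.1) hr0
  · have : (0 : ℝ) ∈ Set.Icc (F δ).det (F 1).det := ⟨by rw [hd]; nlinarith, h.le⟩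
    obtain ⟨r, hr, hr0⟩ := intermediate_value_Icc hδ1 hF.continuousOn this
    exact hne r (hδ.trans_le hr.1) hr0

/-- Counterexample for `k > D`. There is `ε₀ > 0` (depending only on `D`)
such that for every sufficiently small `δ > 0` there are `2D+1` distinct points
`y_1,...,y_{2D+1}` — the first `D+1` the vertices of a regular simplex on the sphere of
radius `δ` about the origin, the last `D+1` the vertices of a regular simplex on the
sphere of radius `1` about some `w₁` — and a self-map `φ : y_i ↦ y_{π i}` of this point
set (an odd permutation of the first simplex fixing the shared vertex `y_{D+1}`, the
identity on the second simplex) that distorts distances by at most a factor `1 + Cδ`,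
yet no bijection `Φ : ℝ^D → ℝ^D` extending `φ` distorts all distances by at most a
factor `1 + ε₀`. -/
theorem no_extension_counterexample (D : ℕ) (hD : 2 ≤ D) :
    ∃ ε₀ > (0 : ℝ), ∃ C > (0 : ℝ), ∃ δ₀ > (0 : ℝ), ∀ δ : ℝ, 0 < δ → δ < δ₀ →
      ∃ (y : Fin (2 * D + 1) → EuclideanSpace ℝ (Fin D))
        (w₁ : EuclideanSpace ℝ (Fin D))
        (π : Fin (2 * D + 1) → Fin (2 * D + 1))
        (σ : Equiv.Perm (Fin (D + 1))),
        Function.Injective y ∧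
        -- the first `D+1` points: a regular simplex on the sphere of radius δ about 0
        (∀ i : Fin (D + 1), ‖y ⟨i.val, by have := i.isLt; omega⟩‖ = δ) ∧
        (∃ s > (0 : ℝ), ∀ i j : Fin (D + 1), i ≠ j →
          dist (y ⟨i.val, by have := i.isLt; omega⟩)
            (y ⟨j.val, by have := j.isLt; omega⟩) = s) ∧
        -- the last `D+1` points: a regular simplex on the sphere of radius 1 about w₁
        (∀ i : Fin (D + 1), dist (y ⟨D + i.val, by have := i.isLt; omega⟩) w₁ = 1) ∧
        (∃ s' > (0 : ℝ), ∀ i j : Fin (D + 1), i ≠ j →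
          dist (y ⟨D + i.val, by have := i.isLt; omega⟩)
            (y ⟨D + j.val, by have := j.isLt; omega⟩) = s') ∧
        -- φ is induced by an odd permutation σ of the first simplex fixing the shared
        -- vertex, and is the identity on the second simplex
        Equiv.Perm.sign σ = -1 ∧
        σ (Fin.last D) = Fin.last D ∧
        (∀ i : Fin (D + 1),
          π ⟨i.val, by have := i.isLt; omega⟩
            = ⟨(σ i).val, by have := (σ i).isLt; omega⟩) ∧
        (∀ i : Fin (2 * D + 1), D ≤ i.val → π i = i) ∧
        -- φ distorts distances by at most a factor 1 + Cδ
        (∀ i j : Fin (2 * D + 1), i ≠ j →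
          (1 + C * δ)⁻¹ * dist (y i) (y j) ≤ dist (y (π i)) (y (π j)) ∧
          dist (y (π i)) (y (π j)) ≤ (1 + C * δ) * dist (y i) (y j)) ∧
        -- yet φ admits no (1+ε₀)-bi-Lipschitz bijective extension to ℝ^D
        ¬ ∃ Φ : EuclideanSpace ℝ (Fin D) → EuclideanSpace ℝ (Fin D),
            Function.Bijective Φ ∧
            (∀ i, Φ (y i) = y (π i)) ∧
            (∀ x x' : EuclideanSpace ℝ (Fin D),
              (1 + ε₀)⁻¹ * dist x x' ≤ dist (Φ x) (Φ x') ∧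
              dist (Φ x) (Φ x') ≤ (1 + ε₀) * dist x x') := by
  obtain ⟨v, s, hs, hn, hv⟩ := aux_simplex D hD
  have hDr : (2 : ℝ) ≤ D := by exact_mod_cast hD
  refine ⟨1 / (10 * D), by positivity, 2, by norm_num, 1 / 2, by norm_num, fun δ hδ hδ2 => ?_⟩
  obtain ⟨Y, hY⟩ : ∃ Y : ℕ → EuclideanSpace ℝ (Fin D), Y = fun k =>
    if k ≤ D then δ • v k else δ • v D + (v (k - D - 1) - v D) := ⟨_, rfl⟩
  have Yle : ∀ k, k ≤ D → Y k = δ • v k := fun k hk => by simp [hY, hk]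
  have Yge : ∀ k, D ≤ k → Y k = (δ • v D - v D) + v (if k = D then D else k - D - 1) := by
    intro k hk
    rcases hk.eq_or_lt with rfl | h
    · rw [Yle _ le_rfl]; simp
    · simp only [hY, not_le.2 h, h.ne', if_false]; abel
  have dle : ∀ i j, i ≤ D → j ≤ D → i ≠ j → dist (Y i) (Y j) = δ * s := by
    intro i j hi hj hij
    rw [Yle i hi, Yle j hj, dist_smul₀, hv i j hi hj hij, Real.norm_eq_abs, abs_of_pos hδ]
  have dge : ∀ i j, D ≤ i → D ≤ j → i < 2 * D + 1 → j < 2 * D + 1 → i ≠ j →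
      dist (Y i) (Y j) = s := by
    intro i j hi hj hi' hj' hij
    rw [Yge i hi, Yge j hj, dist_add_left]
    apply hv <;> split_ifs <;> omega
  have dmix : ∀ i j, i ≤ D → D < j → j < 2 * D + 1 → s / 2 ≤ dist (Y i) (Y j) := by
    intro i j hi hj hj'
    have t1 := dge D j le_rfl hj.le (by omega) hj' hj.ne
    rcases hi.eq_or_lt with rfl | h
    · rw [t1]; linarith
    · have t2 := dle D i le_rfl hi h.ne'
      have t3 := dist_triangle (Y D) (Y i) (Y j)
      nlinarith
  let f : ℕ → ℕ := fun k => Equiv.swap 0 1 k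
  have ff : ∀ k, f (f k) = k := fun k => Equiv.swap_apply_self 0 1 k
  have finj : ∀ i j, i ≠ j → f i ≠ f j := fun i j h h' => h ((Equiv.swap 0 1).injective h')
  have fge : ∀ k, D ≤ k → f k = k := fun k hk =>
    Equiv.swap_apply_of_ne_of_ne (by omega) (by omega)
  have flt : ∀ k, k < D → f k < D := by
    intro k hk
    simp only [f, Equiv.swap_apply_def]; split_ifs <;> omega
  have fle : ∀ k, k ≤ D → f k ≤ D := by
    intro k hk
    rcases hk.eq_or_lt with rfl | h
    · exact (fge _ le_rfl).le
    · exact (flt k h).le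
  have flt2 : ∀ k, k < 2 * D + 1 → f k < 2 * D + 1 := by
    intro k hk
    by_cases h : k < D
    · have := flt k h; omega
    · rw [fge k (by omega)]; exact hk
  have up1 : ∀ i j, i ≤ D → D < j → j < 2 * D + 1 →
      dist (Y (f i)) (Y (f j)) ≤ (1 + 2 * δ) * dist (Y i) (Y j) := by
    intro i j hi hj hj'
    rw [fge j hj.le]
    have t1 := dmix i j hi hj hj'
    by_cases h : f i = i
    · rw [h]
      nlinarith [dist_nonneg (x := Y i) (y := Y j)]
    · have t2 := dle (f i) i (fle i hi) hi h
      have t3 := dist_triangle (Y (f i)) (Y i) (Y j)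
      nlinarith
  have up : ∀ i j, i < 2 * D + 1 → j < 2 * D + 1 → i ≠ j →
      dist (Y (f i)) (Y (f j)) ≤ (1 + 2 * δ) * dist (Y i) (Y j) := by
    intro i j hi hj hij
    have nn : 0 ≤ δ * dist (Y i) (Y j) := by positivity
    rcases le_or_gt i D with h1 | h1 <;> rcases le_or_gt j D with h2 | h2
    · rw [dle (f i) (f j) (fle i h1) (fle j h2) (finj i j hij)]
      rw [dle i j h1 h2 hij] at nn ⊢
      linarith
    · exact up1 i j h1 h2 hj
    · rw [dist_comm, dist_comm (Y i)]; exact up1 j i h2 h1 hi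
    · rw [fge i h1.le, fge j h2.le]; linarith
  have dpos : ∀ i j, i < 2 * D + 1 → j < 2 * D + 1 → i ≠ j → 0 < dist (Y i) (Y j) := by
    intro i j hi hj hij
    rcases le_or_gt i D with h1 | h1 <;> rcases le_or_gt j D with h2 | h2
    · rw [dle i j h1 h2 hij]; positivity
    · have := dmix i j h1 h2 hj; linarith
    · rw [dist_comm]; have := dmix j i h2 h1 hi; linarith
    · rw [dge i j h1.le h2.le hi hj hij]; exact hs
  refine ⟨fun k => Y k, δ • v D - v D, fun k => ⟨f k, flt2 k k.2⟩,
    Equiv.swap ⟨0, by omega⟩ ⟨1, by omega⟩, ?_, ?_, ⟨δ * s, by positivity, ?_⟩, ?_,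
    ⟨s, hs, ?_⟩, ?_, ?_, ?_, ?_, ?_, ?_⟩
  · intro i j hij
    by_contra h
    have := dpos i j i.2 j.2 (fun h' => h (Fin.ext h'))
    have hij' : Y i = Y j := hij
    rw [hij', dist_self] at this
    exact lt_irrefl _ this
  · intro i
    have hi : (i : ℕ) ≤ D := by omega
    show ‖Y i‖ = δ
    rw [Yle i hi, norm_smul, hn i hi, Real.norm_eq_abs, abs_of_pos hδ, mul_one]
  · intro i j hij
    exact dle i j (by omega) (by omega) (fun h => hij (Fin.ext h))
  · intro i
    show dist (Y (D + i)) _ = 1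
    rw [Yge _ (by omega), dist_eq_norm, add_sub_cancel_left]
    apply hn
    split_ifs <;> omega
  · intro i j hij
    exact dge (D + i) (D + j) (by omega) (by omega) (by omega) (by omega)
      (fun h => hij (Fin.ext (by omega)))
  · exact Equiv.Perm.sign_swap (by simp [Fin.ext_iff])
  · refine Equiv.swap_apply_of_ne_of_ne ?_ ?_ <;> simp only [ne_eq, Fin.ext_iff, Fin.val_last] <;>
      omega
  · intro i
    simp only [f, Equiv.swap_apply_def, Fin.ext_iff]
    split_ifs <;> rfl
  · intro i hi
    exact Fin.ext (fge i hi)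
  · intro i j hij
    have hij' : (i : ℕ) ≠ j := fun h => hij (Fin.ext h)
    refine ⟨?_, up i j i.2 j.2 hij'⟩
    rw [inv_mul_le_iff₀ (by positivity)]
    have := up (f i) (f j) (flt2 i i.2) (flt2 j j.2) (finj i j hij')
    rwa [ff, ff] at this
  · rintro ⟨Φ, -, hext, hΦ⟩
    have hext' : ∀ k, k < 2 * D + 1 → Φ (Y k) = Y (f k) := fun k hk => hext ⟨k, hk⟩
    have small : ∀ i, i ≤ D → δ • v D + δ • (v i - v D) = Y i := by
      intro i hi
      rw [Yle i hi, smul_sub]; abel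
    have big : ∀ i, i < D → δ • v D + (v i - v D) = Y (D + 1 + i) := by
      intro i hi
      rw [Yge _ (by omega), if_neg (by omega), show D + 1 + i - D - 1 = i by omega]; abel
    refine aux_noext D hD v s hs hv (δ • v D) δ (1 / (10 * D)) hδ (by linarith) (by positivity)
      ?_ ?_ Φ hΦ ?_ ?_ ?_
    · rw [div_le_one (by positivity)]; linarith
    · have : 9 * (1 / (10 * (D : ℝ))) * D = 9 / 10 := by field_simp
      rw [this]; norm_num
    · rw [← Yle D le_rfl, hext' D (by omega), fge D le_rfl]
    · intro i hi
      rw [big i hi, hext' _ (by omega), fge _ (by omega)]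
    · intro i hi
      rw [small i hi.le, hext' _ (by omega)]
      exact (small (f i) (flt i hi).le).symm
end
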